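/- Every sufficiently small perturbation of the Hopf vector field on S³ has a periodic orbit: let H : ℝ⁴ → ℝ⁴ be the Hopf field H(a,b,c,d) = (−b,a,−d,c). There exists ε > 0 such that for every C¹ map X : S³ → ℝ⁴ satisfying ⟨X p, p⟩ = 0, X p ≠ 0, and ‖X p − H p‖ < ε for all p ∈ S³, there exists a nonconstant differentiable curve γ : ℝ → ℝ⁴ with γ(t) ∈ S³ and γ′(t) = X(γ(t)) for all t, and some T > 0 with γ(t+T) = γ(t) for all t. (Seifert's theorem.) -/

import Mathlib

open Metric Manifold

/-- The Hopf vector field on `ℝ⁴`: `(a,b,c,d) ↦ (−b,a,−d,c)`. -/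
noncomputable def hopfField (p : EuclideanSpace ℝ (Fin 4)) : EuclideanSpace ℝ (Fin 4) :=
  (EuclideanSpace.equiv (Fin 4) ℝ).symm ![-(p 1), p 0, -(p 3), p 2]

section Auxiliary

open MeasureTheory Set Filter Topology Function

section Degree

/-- The determinant of an operator is a fixed linear combination of the values of
`t ↦ det (1 + t A)` at the points of a finite set of large enough cardinality. -/
theorem LinearMap.det_eq_sum_det_one_add_smul {E : Type*} [AddCommGroup E] [Module ℝ E]
    [FiniteDimensional ℝ E] (s : Finset ℝ) (hs : s.card = Module.finrank ℝ E + 1)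
    (A : E →ₗ[ℝ] E) :
    LinearMap.det A =
      ∑ t ∈ s, LinearMap.det (1 + t • A) / ∏ u ∈ s.erase t, (t - u) := by
  classical
  set b := Module.finBasis ℝ E
  set M := LinearMap.toMatrix b b A
  set P : Polynomial ℝ :=
    Matrix.det ((Polynomial.X : Polynomial ℝ) • M.map Polynomial.C +
      (1 : Matrix _ _ ℝ).map Polynomial.C) with hP
  have hdeg : P.natDegree ≤ Module.finrank ℝ E := by
    have := Polynomial.natDegree_det_X_add_C_le M 1
    rwa [Fintype.card_fin] at this
  have hcoeff : P.coeff (Module.finrank ℝ E) = LinearMap.det A := by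
    have := Polynomial.coeff_det_X_add_C_card M 1
    rw [Fintype.card_fin] at this
    rw [hP, this, LinearMap.det_toMatrix]
  have heval : ∀ t : ℝ, P.eval t = LinearMap.det (1 + t • A) := by
    intro t
    rw [hP, ← LinearMap.det_toMatrix b, ← Polynomial.coe_evalRingHom, RingHom.map_det]
    congr 1
    ext i j
    simp only [RingHom.mapMatrix_apply, Matrix.map_apply, Matrix.add_apply, Matrix.smul_apply,
      smul_eq_mul, Polynomial.coe_evalRingHom, Polynomial.eval_mul,
      Polynomial.eval_X, Polynomial.eval_C, map_add, map_smul, LinearMap.toMatrix_one, M]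
    ring
  have hlt : P.degree < s.card := by
    rw [hs]
    exact lt_of_le_of_lt Polynomial.degree_le_natDegree
      (by exact_mod_cast Nat.lt_succ_of_le hdeg)
  have := Lagrange.coeff_eq_sum (s := s) (v := fun t => t) (fun _ _ _ _ h => h) hlt
  rw [hs, Nat.add_sub_cancel, hcoeff] at this
  simpa only [heval] using this

/-- A finite set of reals in a right neighbourhood of zero, of any prescribed size. -/
theorem exists_finset_card_subset_Ioo {δ : ℝ} (hδ : 0 < δ) (n : ℕ) :
    ∃ s : Finset ℝ, s.card = n ∧ ∀ t ∈ s, t ∈ Ioo 0 δ := by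
  obtain ⟨s, hs, hn⟩ := (Ioo_infinite hδ).exists_subset_card_eq n
  exact ⟨s, hn, fun t ht => hs ht⟩

variable {E : Type*} [NormedAddCommGroup E] [NormedSpace ℝ E] [FiniteDimensional ℝ E]

/-- A small multiple of a Lipschitz map is a bijective perturbation of the identity. -/
theorem LipschitzWith.bijective_id_add_smul {f : E → E} {L : NNReal} (hf : LipschitzWith L f)
    {t : ℝ} (ht : |t| * L < 1) : Bijective fun x => x + t • f x := by
  have happ : ApproximatesLinearOn (fun x => x + t • f x)
      ((ContinuousLinearEquiv.refl ℝ E : E ≃L[ℝ] E) : E →L[ℝ] E) univ (‖t‖₊ * L) := by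
    intro x _ y _
    have : x + t • f x - (y + t • f y) -
        ((ContinuousLinearEquiv.refl ℝ E : E ≃L[ℝ] E) : E →L[ℝ] E) (x - y) =
        t • (f x - f y) := by
      simp [smul_sub]; abel
    rw [this, norm_smul]
    have h2 := hf.norm_sub_le x y
    push_cast
    rw [mul_assoc]
    exact mul_le_mul_of_nonneg_left h2 (norm_nonneg _)
  have hc : Subsingleton E ∨ ‖t‖₊ * L <
      ‖(((ContinuousLinearEquiv.refl ℝ E).symm : E ≃L[ℝ] E) : E →L[ℝ] E)‖₊⁻¹ := by
    rcases subsingleton_or_nontrivial E with h | h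
    · exact Or.inl h
    · right
      have : ‖(((ContinuousLinearEquiv.refl ℝ E).symm : E ≃L[ℝ] E) : E →L[ℝ] E)‖₊ = 1 := by
        exact NNReal.eq (ContinuousLinearMap.norm_id (𝕜 := ℝ) (E := E))
      rw [this, inv_one]
      exact_mod_cast ht
  exact ⟨injOn_univ.1 (happ.injOn hc), happ.surjective hc⟩

variable [MeasurableSpace E] [BorelSpace E]

theorem integral_closedBall_det_one_add_smul {μ : Measure E} [μ.IsAddHaarMeasure] {f : E → E}
    (hf : ContDiff ℝ 1 f) {R : ℝ} (hR : ∀ x, x ∉ closedBall (0 : E) R → f x = 0)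
    (hs : HasCompactSupport f) :
    ∃ δ > 0, ∀ t ∈ Ioo (0 : ℝ) δ,
      ∫ x in closedBall (0 : E) R, LinearMap.det (1 + t • (fderiv ℝ f x : E →ₗ[ℝ] E)) ∂μ =
        μ.real (closedBall (0 : E) R) := by
  obtain ⟨L, hL⟩ := hf.lipschitzWith_of_hasCompactSupport hs one_ne_zero
  have hcont : Continuous fun A : E →L[ℝ] E => (1 + A).det :=
    ContinuousLinearMap.continuous_det.comp (continuous_const.add continuous_id)
  have hpos : ∀ᶠ A in 𝓝 (0 : E →L[ℝ] E), 0 < (1 + A).det := by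
    refine continuousAt_const.eventually_lt hcont.continuousAt ?_
    simp [ContinuousLinearMap.det]
  obtain ⟨η, hη, hball⟩ := Metric.eventually_nhds_iff.1 hpos
  refine ⟨min (1 / (L + 1)) (η / (L + 1)), by positivity, fun t ht => ?_⟩
  have hL0 : (0 : ℝ) ≤ L := L.2
  have ht0 : 0 < t := ht.1
  have ht1 : t * (L + 1) < 1 := by
    have := lt_of_lt_of_le ht.2 (min_le_left _ _)
    rwa [lt_div_iff₀ (by positivity)] at this
  have ht2 : t * (L + 1) < η := by
    have := lt_of_lt_of_le ht.2 (min_le_right _ _)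
    rwa [lt_div_iff₀ (by positivity)] at this
  have hbij := hL.bijective_id_add_smul (t := t) (by rw [abs_of_pos ht0]; nlinarith)
  set Φ : E → E := fun x => x + t • f x with hΦ
  have hder : ∀ x, HasFDerivAt Φ (1 + t • fderiv ℝ f x) x := fun x =>
    (hasFDerivAt_id x).add
      (((hf.differentiable one_ne_zero) x).hasFDerivAt.const_smul t)
  have hdet : ∀ x, 0 < (1 + t • fderiv ℝ f x).det := by
    intro x
    apply hball
    rw [dist_zero_right, norm_smul, Real.norm_of_nonneg ht0.le]
    have := norm_fderiv_le_of_lipschitz ℝ hL (x₀ := x)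
    nlinarith
  have himage : Φ '' closedBall 0 R = closedBall 0 R := by
    have hout : ∀ x, x ∉ closedBall (0 : E) R → Φ x = x := fun x hx => by simp [hΦ, hR x hx]
    ext y
    constructor
    · rintro ⟨x, hx, rfl⟩
      by_contra hy
      have := hbij.1 (hout _ hy)
      rw [this] at hy
      exact hy hx
    · intro hy
      obtain ⟨x, rfl⟩ := hbij.2 y
      refine ⟨x, ?_, rfl⟩
      by_contra hx
      rw [show Φ x = x from hout x hx] at hy
      exact hx hy
  have hmeas : MeasurableSet (closedBall (0 : E) R) := measurableSet_closedBall
  have key := integral_image_eq_integral_abs_det_fderiv_smul μ hmeas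
    (fun x _ => (hder x).hasFDerivWithinAt) hbij.1.injOn (fun _ => (1 : ℝ))
  rw [himage] at key
  simp only [smul_eq_mul, mul_one, integral_const, measureReal_restrict_apply_univ] at key
  rw [key]
  refine integral_congr_ae (Eventually.of_forall fun x => ?_)
  simp only []
  rw [abs_of_pos (hdet x)]
  rfl

/-- The Jacobian determinant of a compactly supported `C¹` map integrates to zero. -/
theorem integral_det_fderiv_eq_zero [Nontrivial E] (μ : Measure E) [μ.IsAddHaarMeasure] {f : E → E}
    (hf : ContDiff ℝ 1 f) (hs : HasCompactSupport f) :
    ∫ x, (fderiv ℝ f x).det ∂μ = 0 := by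
  classical
  obtain ⟨R, hR⟩ := hs.isCompact.isBounded.subset_closedBall (0 : E)
  have hR' : ∀ x, x ∉ closedBall (0 : E) R → f x = 0 := fun x hx =>
    image_eq_zero_of_notMem_tsupport fun h => hx (hR h)
  obtain ⟨δ, hδ, hdet⟩ := integral_closedBall_det_one_add_smul (μ := μ) hf hR' hs
  obtain ⟨s, hcard, hsub⟩ := exists_finset_card_subset_Ioo hδ (Module.finrank ℝ E + 1)
  have hfd : Continuous (fderiv ℝ f) := hf.continuous_fderiv one_ne_zero
  have hout : ∀ x, x ∉ closedBall (0 : E) R → (fderiv ℝ f x).det = 0 := by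
    intro x hx
    have : fderiv ℝ f x = 0 := by
      have hx' : x ∉ tsupport f := fun h => hx (hR h)
      exact image_eq_zero_of_notMem_tsupport fun h => hx' (tsupport_fderiv_subset ℝ h)
    rw [this]
    simp [ContinuousLinearMap.det]
  rw [← setIntegral_eq_integral_of_forall_compl_eq_zero (s := closedBall (0 : E) R) hout]
  have hInt : ∀ t : ℝ, IntegrableOn
      (fun x => LinearMap.det (1 + t • (fderiv ℝ f x : E →ₗ[ℝ] E))) (closedBall (0 : E) R) μ := by
    intro t
    have : Continuous fun x => (1 + t • fderiv ℝ f x).det :=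
      ContinuousLinearMap.continuous_det.comp (continuous_const.add (hfd.const_smul t))
    exact this.continuousOn.integrableOn_compact (isCompact_closedBall _ _)
  calc ∫ x in closedBall (0 : E) R, (fderiv ℝ f x).det ∂μ
      = ∫ x in closedBall (0 : E) R, ∑ t ∈ s,
          LinearMap.det (1 + t • (fderiv ℝ f x : E →ₗ[ℝ] E)) /
            ∏ u ∈ s.erase t, (t - u) ∂μ := by
        refine integral_congr_ae (Eventually.of_forall fun x => ?_)
        exact LinearMap.det_eq_sum_det_one_add_smul s hcard _
    _ = ∑ t ∈ s, μ.real (closedBall (0 : E) R) / ∏ u ∈ s.erase t, (t - u) := by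
        rw [integral_finsetSum _ fun t _ => (hInt t).div_const _]
        refine Finset.sum_congr rfl fun t ht => ?_
        rw [integral_div, hdet t (hsub t ht)]
    _ = 0 := by
        have h0 := LinearMap.det_eq_sum_det_one_add_smul s hcard (0 : E →ₗ[ℝ] E)
        simp only [smul_zero, add_zero, map_one, LinearMap.det_zero,
          zero_pow Module.finrank_pos.ne'] at h0
        have : ∑ t ∈ s, μ.real (closedBall (0 : E) R) / ∏ u ∈ s.erase t, (t - u) =
            μ.real (closedBall (0 : E) R) * ∑ t ∈ s, 1 / ∏ u ∈ s.erase t, (t - u) := by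
          rw [Finset.mul_sum]
          exact Finset.sum_congr rfl fun t _ => by ring
        rw [this, ← h0, mul_zero]

end Degree

section Radial

/-- The profile `k` for which `y ↦ k (‖y‖ ^ 2) • y` is a `C¹` radial retraction of the exterior of
the unit ball onto the unit sphere, orientation preserving inside the ball. -/
noncomputable def radialProfile (s : ℝ) : ℝ := (1 - min s 1) / 2 + (max s 1) ^ (-(1 / 2) : ℝ)

/-- The derivative of `radialProfile`. -/
noncomputable def radialProfileDeriv (s : ℝ) : ℝ := -(1 / 2) * (max s 1) ^ (-(3 / 2) : ℝ)

theorem hasDerivAt_radialProfile (s : ℝ) :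
    HasDerivAt radialProfile (radialProfileDeriv s) s := by
  have hlow : ∀ u : ℝ, u ≤ 1 → radialProfile u = (1 - u) / 2 + 1 := fun u hu => by
    simp [radialProfile, min_eq_left hu, max_eq_right hu]
  have hhigh : ∀ u : ℝ, 1 ≤ u → radialProfile u = u ^ (-(1 / 2) : ℝ) := fun u hu => by
    simp [radialProfile, min_eq_right hu, max_eq_left hu]
  have dlow : ∀ u : ℝ, u ≤ 1 → HasDerivAt (fun u : ℝ => (1 - u) / 2 + 1)
      (radialProfileDeriv u) u := fun u hu => by
    have := (((hasDerivAt_id u).const_sub 1).div_const 2).add_const 1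
    refine HasDerivAt.congr_deriv this ?_
    rw [radialProfileDeriv, max_eq_right hu, Real.one_rpow]
    norm_num
  have dhigh : ∀ u : ℝ, 1 ≤ u → HasDerivAt (fun u : ℝ => u ^ (-(1 / 2) : ℝ))
      (radialProfileDeriv u) u := fun u hu => by
    have := Real.hasDerivAt_rpow_const (x := u) (p := (-(1 / 2) : ℝ)) (Or.inl (by linarith))
    refine HasDerivAt.congr_deriv this ?_
    rw [radialProfileDeriv, max_eq_left hu]
    norm_num
  rcases lt_trichotomy s 1 with h | rfl | h
  · refine (dlow s h.le).congr_of_eventuallyEq ?_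
    filter_upwards [Iio_mem_nhds h] with u hu using hlow u (le_of_lt hu)
  · have h1 : HasDerivWithinAt radialProfile (radialProfileDeriv 1) (Iic 1) 1 :=
      (dlow 1 le_rfl).hasDerivWithinAt.congr (fun u hu => hlow u hu) (hlow 1 le_rfl)
    have h2 : HasDerivWithinAt radialProfile (radialProfileDeriv 1) (Ici 1) 1 :=
      (dhigh 1 le_rfl).hasDerivWithinAt.congr (fun u hu => hhigh u hu) (hhigh 1 le_rfl)
    have := h1.union h2
    rwa [Iic_union_Ici, hasDerivWithinAt_univ] at this
  · refine (dhigh s h.le).congr_of_eventuallyEq ?_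
    filter_upwards [Ioi_mem_nhds h] with u hu using hhigh u (le_of_lt hu)

theorem continuous_radialProfileDeriv : Continuous radialProfileDeriv := by
  unfold radialProfileDeriv
  refine continuous_const.mul (Continuous.rpow_const (by fun_prop) fun s => Or.inl ?_)
  have := le_max_right s 1
  linarith

theorem contDiff_radialProfile : ContDiff ℝ 1 radialProfile := by
  rw [contDiff_one_iff_deriv]
  refine ⟨fun s => (hasDerivAt_radialProfile s).differentiableAt, ?_⟩
  rw [show deriv radialProfile = radialProfileDeriv from
    funext fun s => (hasDerivAt_radialProfile s).deriv]
  exact continuous_radialProfileDeriv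

theorem radialProfile_pos (s : ℝ) : 0 < radialProfile s := by
  have h1 := le_max_right s 1
  have h2 := min_le_right s 1
  have : (0 : ℝ) < (max s 1) ^ (-(1 / 2) : ℝ) := Real.rpow_pos_of_pos (by linarith) _
  unfold radialProfile
  linarith

theorem radialProfile_add_eq (s : ℝ) :
    radialProfile s + 2 * s * radialProfileDeriv s = 3 / 2 * (1 - min s 1) := by
  rcases le_total s 1 with h | h
  · simp [radialProfile, radialProfileDeriv, min_eq_left h, max_eq_right h]
    ring
  · simp only [radialProfile, radialProfileDeriv, min_eq_right h, max_eq_left h]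
    have : s * s ^ (-(3 / 2) : ℝ) = s ^ (-(1 / 2) : ℝ) := by
      rw [← Real.rpow_one_add' (by linarith) (by norm_num)]
      norm_num
    linear_combination -this

theorem radialProfile_sq_mul_norm {x : ℝ} (hx : 1 ≤ x) : radialProfile (x ^ 2) * x = 1 := by
  have h : (1 : ℝ) ≤ x ^ 2 := by nlinarith
  have h0 : (0 : ℝ) ≤ x := by linarith
  simp only [radialProfile, min_eq_right h, max_eq_left h]
  rw [← Real.rpow_natCast x 2, ← Real.rpow_mul h0]
  norm_num
  rw [Real.rpow_neg_one]
  field_simp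

variable {E F : Type*} [NormedAddCommGroup E] [NormedSpace ℝ E] [FiniteDimensional ℝ E]
  [NormedAddCommGroup F] [InnerProductSpace ℝ F]

/-- A `C¹` map sending the exterior of an ellipsoid to its boundary, and preserving the
orientation in its interior. -/
theorem exists_contDiff_radial_retraction (e : E ≃L[ℝ] F) :
    ∃ r : E → E, ContDiff ℝ 1 r ∧ (∀ y, 1 ≤ ‖e y‖ → ‖e (r y)‖ = 1) ∧
      (∀ y, 0 ≤ (fderiv ℝ r y).det) ∧ ∀ y, ‖e y‖ < 1 → 0 < (fderiv ℝ r y).det := by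
  set q : E → ℝ := fun y => ‖e y‖ ^ 2 with hq
  have hqc : ContDiff ℝ 1 q := e.contDiff.norm_sq ℝ
  set r : E → E := fun y => radialProfile (q y) • y with hr
  have hqd : ∀ y, HasFDerivAt q ((2 : ℝ) • (innerSL ℝ (e y)).comp (e : E →L[ℝ] F)) y := by
    intro y
    refine (e.hasFDerivAt (x := y)).norm_sq.congr_fderiv ?_
    ext v
    simp [two_smul]
  have hd : ∀ y, HasFDerivAt r (radialProfile (q y) • ContinuousLinearMap.id ℝ E +
      (radialProfileDeriv (q y) • ((2 : ℝ) • (innerSL ℝ (e y)).comp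
        (e : E →L[ℝ] F))).smulRight y) y := fun y =>
    ((hasDerivAt_radialProfile (q y)).comp_hasFDerivAt y (hqd y)).smul (hasFDerivAt_id y)
  have hdet : ∀ y, (fderiv ℝ r y).det = radialProfile (q y) ^ Module.finrank ℝ E *
      ((3 / 2 * (1 - min (q y) 1)) / radialProfile (q y)) := by
    intro y
    have hk := radialProfile_pos (q y)
    rw [(hd y).fderiv]
    set φ : Module.Dual ℝ E := ((radialProfileDeriv (q y) * 2 / radialProfile (q y)) •
      ((innerSL ℝ (e y)).comp (e : E →L[ℝ] F) : E →L[ℝ] ℝ)).toLinearMap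
    have h1 : ((radialProfile (q y) • ContinuousLinearMap.id ℝ E +
      (radialProfileDeriv (q y) • ((2 : ℝ) • (innerSL ℝ (e y)).comp
        (e : E →L[ℝ] F))).smulRight y : E →L[ℝ] E) : E →ₗ[ℝ] E) =
        radialProfile (q y) • LinearMap.transvection φ y := by
      ext v
      simp [φ, LinearMap.transvection, smul_smul]
      congr 1
      field_simp
    rw [ContinuousLinearMap.det, h1, LinearMap.det_smul, LinearMap.transvection.det]
    congr 1
    have h2 : φ y = radialProfileDeriv (q y) * 2 / radialProfile (q y) * q y := by
      simp [φ, hq]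
    rw [h2, ← radialProfile_add_eq]
    field_simp
  refine ⟨r, (contDiff_radialProfile.comp hqc).smul contDiff_id, fun y hy => ?_, fun y => ?_,
    fun y hy => ?_⟩
  · simp only [hr, map_smul, norm_smul, Real.norm_of_nonneg (radialProfile_pos _).le, hq]
    exact radialProfile_sq_mul_norm hy
  · rw [hdet]
    have := radialProfile_pos (q y)
    have := min_le_right (q y) 1
    have : 0 ≤ 1 - min (q y) 1 := by linarith
    positivity
  · rw [hdet]
    have := radialProfile_pos (q y)
    have : min (q y) 1 < 1 := by
      refine lt_of_le_of_lt (min_le_left _ _) ?_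
      have := norm_nonneg (e y)
      simp only [hq]; nlinarith
    have : 0 < 1 - min (q y) 1 := by linarith
    positivity

end Radial

section ExistsZero

theorem ContinuousLinearMap.det_comp {E : Type*} [NormedAddCommGroup E] [NormedSpace ℝ E]
    (A B : E →L[ℝ] E) : (A.comp B).det = A.det * B.det :=
  LinearMap.det_comp (A : E →ₗ[ℝ] E) (B : E →ₗ[ℝ] E)

variable {E : Type*} [NormedAddCommGroup E] [NormedSpace ℝ E] [FiniteDimensional ℝ E]

theorem det_fderiv_eq_zero_of_norm_eq_one {F : Type*} [NormedAddCommGroup F]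
    [InnerProductSpace ℝ F] (e : E ≃L[ℝ] F) {f : E → E} {x : E} (hf : DifferentiableAt ℝ f x)
    (h : ∀ x, ‖e (f x)‖ = 1) : (fderiv ℝ f x).det = 0 := by
  by_contra hdet
  have hsurj : Surjective (fderiv ℝ f x : E →ₗ[ℝ] E) :=
    ((LinearMap.equivOfDetNeZero _ hdet).surjective :)
  obtain ⟨v, hv⟩ := hsurj (f x)
  have h1 : HasFDerivAt (fun x => e (f x)) ((e : E →L[ℝ] F).comp (fderiv ℝ f x)) x :=
    e.hasFDerivAt.comp x hf.hasFDerivAt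
  have h2 := h1.norm_sq
  have h3 : (fun x => ‖e (f x)‖ ^ 2) = fun _ => (1 : ℝ) := by
    funext x; rw [h x, one_pow]
  rw [h3] at h2
  have h4 := h2.unique (hasFDerivAt_const (1 : ℝ) x)
  have h5 := congrArg (fun A => A v) h4
  have hv' : fderiv ℝ f x v = f x := hv
  simp [hv', h x] at h5

/-- A continuous map agreeing outside a ball with an orientation preserving `C¹` map of nonzero
degree at the origin has a zero. -/
theorem exists_eq_zero_of_eqOn_compl_closedBall [Nontrivial E] {G g : E → E} {R c : ℝ}
    (hG : ContDiff ℝ 1 G) (hdet : ∀ x, 0 ≤ (fderiv ℝ G x).det)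
    (hpos : ∀ δ > 0, ∃ x, ‖G x‖ < δ ∧ 0 < (fderiv ℝ G x).det) (hc : 0 < c)
    (hGR : ∀ x, x ∉ closedBall (0 : E) R → c ≤ ‖G x‖) (hg : Continuous g)
    (hgG : ∀ x, x ∉ closedBall (0 : E) R → g x = G x) : ∃ x, g x = 0 := by
  by_contra! hne
  obtain ⟨c₁, hc₁, hgc⟩ : ∃ c₁ > 0, ∀ x, c₁ ≤ ‖g x‖ := by
    obtain ⟨c₂, hc₂, h⟩ := (isCompact_closedBall (0 : E) R).exists_forall_le'
      (f := fun x => ‖g x‖) hg.norm.continuousOn (a := 0) (fun x _ => norm_pos_iff.2 (hne x))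
    refine ⟨min c c₂, lt_min hc hc₂, fun x => ?_⟩
    by_cases hx : x ∈ closedBall (0 : E) R
    · exact (min_le_right _ _).trans (h x hx)
    · rw [hgG x hx]; exact (min_le_left _ _).trans (hGR x hx)
  set e := toEuclidean (E := E)
  obtain ⟨K, hK, heK⟩ : ∃ K > 0, ∀ y, ‖y‖ ≤ K * ‖e y‖ := by
    refine ⟨‖(e.symm : EuclideanSpace ℝ (Fin (Module.finrank ℝ E)) →L[ℝ] E)‖ + 1, by positivity, fun y => ?_⟩
    have := (e.symm : EuclideanSpace ℝ (Fin (Module.finrank ℝ E)) →L[ℝ] E).le_opNorm (e y)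
    simp only [ContinuousLinearEquiv.coe_coe, ContinuousLinearEquiv.symm_apply_apply] at this
    nlinarith [norm_nonneg (e y)]
  set u : E → E := fun x => g x - G x with hu
  have huc : Continuous u := hg.sub hG.continuous
  have hu0 : ∀ x, x ∉ closedBall (0 : E) R → u x = 0 := fun x hx => by simp [hu, hgG x hx]
  have huu : UniformContinuous u := HasCompactSupport.uniformContinuous_of_continuous
    (HasCompactSupport.intro (isCompact_closedBall (0 : E) R) hu0) huc
  obtain ⟨η, hη, huη⟩ := Metric.uniformContinuous_iff.1 huu (c₁ / 2) (by positivity)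
  obtain ⟨v, hv, hvu⟩ := huc.exists_contDiff_dist_le_of_forall_mem_ball_dist_le
    (lt_min hη one_pos)
  have hvu1 : ∀ x, ‖v x - u x‖ ≤ c₁ / 2 := fun x => by
    rw [← dist_eq_norm]
    exact hvu x _ fun y hy => (huη ((mem_ball.1 hy).trans_le (min_le_left _ _))).le
  have hv0 : ∀ x, x ∉ closedBall (0 : E) (R + 1) → v x = 0 := fun x hx => by
    have hx' : R + 1 < ‖x‖ := by simpa using hx
    have h0 : ∀ y ∈ ball x (min η 1), u y = 0 := fun y hy => by
      refine hu0 y fun hy' => ?_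
      have h1 : ‖y‖ ≤ R := by simpa using hy'
      have h2 : dist y x < 1 := (mem_ball.1 hy).trans_le (min_le_right _ _)
      rw [dist_comm, dist_eq_norm] at h2
      have := norm_sub_norm_le x y
      linarith
    have hux := h0 x (mem_ball_self (lt_min hη one_pos))
    have := hvu x 0 fun y hy => by rw [h0 y hy, hux, dist_self]
    rw [hux, dist_zero_right] at this
    exact norm_le_zero_iff.1 this
  obtain ⟨r, hr, hr1, hr2, hr3⟩ := exists_contDiff_radial_retraction e
  set δ : ℝ := c₁ / 2 / K with hδ
  have hδ0 : 0 < δ := by positivity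
  set F₁ : E → E := fun x => r (δ⁻¹ • (G x + v x)) with hF₁
  set F₂ : E → E := fun x => r (δ⁻¹ • G x) with hF₂
  have hF₁c : ContDiff ℝ 1 F₁ :=
    hr.comp ((hG.add (hv.of_le (by norm_cast))).const_smul δ⁻¹)
  have hF₂c : ContDiff ℝ 1 F₂ := hr.comp (hG.const_smul δ⁻¹)
  have hF₁n : ∀ x, ‖e (F₁ x)‖ = 1 := fun x => by
    refine hr1 _ ?_
    have h1 : c₁ / 2 ≤ ‖G x + v x‖ := by
      have h2 := hvu1 x
      have h3 := norm_sub_le (G x + v x) (v x - u x)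
      have h4 : G x + v x - (v x - u x) = g x := by simp only [hu]; abel
      rw [h4] at h3
      have := hgc x
      linarith
    have h5 := heK (G x + v x)
    rw [map_smul, norm_smul, norm_inv, Real.norm_of_nonneg hδ0.le]
    rw [← div_eq_inv_mul, le_div_iff₀ hδ0, one_mul, hδ, div_le_iff₀ hK]
    linarith
  have hF₁₂ : ∀ x, x ∉ closedBall (0 : E) (R + 1) → F₁ x = F₂ x := fun x hx => by
    simp only [hF₁, hF₂, hv0 x hx, add_zero]
  borelize E
  set μ : Measure E := Measure.addHaar
  obtain ⟨S, hS0, hS⟩ : ∃ S > 0, R + 1 < S := ⟨max (R + 2) 1, by positivity, by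
    have := le_max_left (R + 2) 1; linarith⟩
  set χ : ContDiffBump (0 : E) := ⟨S, S + 1, hS0, by linarith⟩
  have hχc : ContDiff ℝ 1 χ := χ.contDiff
  set D : (E → E) → E → ℝ := fun F x => (fderiv ℝ (fun y => χ y • F y) x).det with hD
  have hcomp : ∀ F : E → E, HasCompactSupport fun y => χ y • F y := fun F =>
    χ.hasCompactSupport.smul_right
  have hDint : ∀ F : E → E, ContDiff ℝ 1 F → ∫ x, D F x ∂μ = 0 := fun F hF =>
    integral_det_fderiv_eq_zero μ (hχc.smul hF) (hcomp F)
  have hDcont : ∀ F : E → E, ContDiff ℝ 1 F → Continuous (D F) := fun F hF =>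
    ContinuousLinearMap.continuous_det.comp ((hχc.smul hF).continuous_fderiv one_ne_zero)
  have hfd0 : (0 : E →L[ℝ] E).det = 0 := by
    rw [ContinuousLinearMap.det, ContinuousLinearMap.toLinearMap_zero, LinearMap.det_zero,
      zero_pow Module.finrank_pos.ne']
  have hDsupp : ∀ F : E → E, HasCompactSupport (D F) := fun F =>
    (HasCompactSupport.fderiv ℝ (hcomp F)).comp_left (g := fun A : E →L[ℝ] E => A.det) hfd0
  have hDin : ∀ F : E → E, ∀ x ∈ closedBall (0 : E) (R + 1), D F x = (fderiv ℝ F x).det := by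
    intro F x hx
    have : (fun y => χ y • F y) =ᶠ[𝓝 x] F := by
      have hx' : ‖x‖ < S := lt_of_le_of_lt (by simpa using hx) hS
      filter_upwards [isOpen_ball.mem_nhds (mem_ball_zero_iff.2 hx')] with y hy
      rw [χ.one_of_mem_closedBall (ball_subset_closedBall hy), one_smul]
    simp only [hD, this.fderiv_eq]
  have hDout : ∀ x, x ∉ closedBall (0 : E) (R + 1) → D F₁ x = D F₂ x := by
    intro x hx
    have : (fun y => χ y • F₁ y) =ᶠ[𝓝 x] fun y => χ y • F₂ y := by
      filter_upwards [isClosed_closedBall.isOpen_compl.mem_nhds hx] with y hy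
      rw [hF₁₂ y hy]
    simp only [hD, this.fderiv_eq]
  have hF₁0 : ∀ x, (fderiv ℝ F₁ x).det = 0 := fun x =>
    det_fderiv_eq_zero_of_norm_eq_one e ((hF₁c.differentiable one_ne_zero) x) hF₁n
  have hF₂d : ∀ x, (fderiv ℝ F₂ x).det = (fderiv ℝ r (δ⁻¹ • G x)).det *
      (δ⁻¹ ^ Module.finrank ℝ E * (fderiv ℝ G x).det) := fun x => by
    have h1 : HasFDerivAt F₂ ((fderiv ℝ r (δ⁻¹ • G x)).comp (δ⁻¹ • fderiv ℝ G x)) x :=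
      ((hr.differentiable one_ne_zero) _).hasFDerivAt.comp x
        (((hG.differentiable one_ne_zero) x).hasFDerivAt.const_smul δ⁻¹)
    rw [h1.fderiv, ContinuousLinearMap.det_comp]
    congr 1
    exact LinearMap.det_smul _ _
  have hnonneg : ∀ x, 0 ≤ D F₂ x - D F₁ x := fun x => by
    by_cases hx : x ∈ closedBall (0 : E) (R + 1)
    · rw [hDin _ x hx, hDin _ x hx, hF₁0, sub_zero, hF₂d]
      have := hr2 (δ⁻¹ • G x)
      have := hdet x
      positivity
    · rw [hDout x hx, sub_self]
  obtain ⟨x₀, hx₀, hx₀'⟩ := hpos (min c (δ / (‖(e : E →L[ℝ] EuclideanSpace ℝ (Fin (Module.finrank ℝ E)))‖ + 1))) (by positivity)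
  have hx₀in : x₀ ∈ closedBall (0 : E) (R + 1) := by
    by_contra h
    have : x₀ ∉ closedBall (0 : E) R := fun h' => h (closedBall_subset_closedBall (by linarith) h')
    exact absurd (hx₀.trans_le (min_le_left _ _)) (not_lt.2 (hGR _ this))
  have hx₀pos : D F₂ x₀ - D F₁ x₀ ≠ 0 := by
    rw [hDin _ _ hx₀in, hDin _ _ hx₀in, hF₁0, sub_zero, hF₂d]
    have h1 : ‖e (δ⁻¹ • G x₀)‖ < 1 := by
      rw [map_smul, norm_smul, norm_inv, Real.norm_of_nonneg hδ0.le, ← div_eq_inv_mul,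
        div_lt_one hδ0]
      have h2 := (e : E →L[ℝ] EuclideanSpace ℝ (Fin (Module.finrank ℝ E))).le_opNorm (G x₀)
      have h3 := hx₀.trans_le (min_le_right _ _)
      rw [lt_div_iff₀ (by positivity)] at h3
      simp only [ContinuousLinearEquiv.coe_coe] at h2
      nlinarith [norm_nonneg (G x₀)]
    have := hr3 _ h1
    positivity
  have hfin := (hDcont F₂ hF₂c).sub (hDcont F₁ hF₁c) |>.integral_pos_of_hasCompactSupport_nonneg_nonzero
    (μ := μ) ((hDsupp F₂).sub (hDsupp F₁)) hnonneg hx₀pos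
  have hz : ∫ x, (D F₂ x - D F₁ x) ∂μ = 0 := by
    rw [integral_sub ((hDcont F₂ hF₂c).integrable_of_hasCompactSupport (hDsupp F₂))
      ((hDcont F₁ hF₁c).integrable_of_hasCompactSupport (hDsupp F₁)), hDint _ hF₂c, hDint _ hF₁c,
      sub_self]
  exact hfin.ne' hz

end ExistsZero

section Equivariant

/-- The argument of a complex number as an element of the circle. -/
noncomputable def Complex.phase (a : ℂ) : Circle := (Complex.arg a : Real.Angle).toCircle

theorem Complex.norm_mul_phase (a : ℂ) : (‖a‖ : ℂ) * (phase a : ℂ) = a := by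
  rw [phase, Real.Angle.toCircle_coe, Circle.coe_exp, norm_mul_exp_arg_mul_I]

theorem Complex.phase_coe (u : Circle) : phase u = u := by
  apply Circle.ext
  have := norm_mul_phase (u : ℂ)
  rwa [Circle.norm_coe, ofReal_one, one_mul] at this

theorem Complex.continuousAt_phase {a : ℂ} (ha : a ≠ 0) : ContinuousAt phase a :=
  have h : Continuous Real.Angle.toCircle :=
    continuous_coinduced_dom.mpr (Circle.exp.continuous : Continuous Circle.exp)
  h.continuousAt.comp (continuousAt_arg_coe_angle ha)

/-- The radial projection of the complex plane to the closed unit disc. -/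
noncomputable def diskProj (a : ℂ) : ℂ := (max 1 ‖a‖)⁻¹ • a

theorem continuous_diskProj : Continuous diskProj := by
  unfold diskProj
  refine Continuous.smul (Continuous.inv₀ (continuous_const.max continuous_norm) fun a => ?_)
    continuous_id
  positivity

theorem norm_diskProj_le (a : ℂ) : ‖diskProj a‖ ≤ 1 := by
  rw [diskProj, norm_smul, norm_inv, Real.norm_of_nonneg (by positivity), ← div_eq_inv_mul]
  exact div_le_one_of_le₀ (le_max_right _ _) (by positivity)

theorem diskProj_of_norm_le {a : ℂ} (ha : ‖a‖ ≤ 1) : diskProj a = a := by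
  rw [diskProj, max_eq_left ha, inv_one, one_smul]

theorem diskProj_of_le_norm {a : ℂ} (ha : 1 ≤ ‖a‖) : diskProj a = Complex.phase a := by
  have h0 : (‖a‖ : ℂ) ≠ 0 := by
    norm_cast; linarith
  rw [diskProj, max_eq_right ha, Complex.real_smul, Complex.ofReal_inv, inv_mul_eq_iff_eq_mul₀ h0,
    Complex.norm_mul_phase]

/-- The piecewise linear cutoff function with value `0` for `t ≤ 0` and `1` for `1 ≤ t`. -/
noncomputable def ramp (t : ℝ) : ℝ := max 0 (min t 1)

theorem continuous_ramp : Continuous ramp := by unfold ramp; fun_prop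

theorem ramp_nonneg (t : ℝ) : 0 ≤ ramp t := le_max_left _ _

theorem ramp_le_one (t : ℝ) : ramp t ≤ 1 := max_le zero_le_one (min_le_right _ _)

theorem ramp_of_nonpos {t : ℝ} (h : t ≤ 0) : ramp t = 0 := by
  rw [ramp, min_eq_left (by linarith), max_eq_left h]

theorem ramp_of_one_le {t : ℝ} (h : 1 ≤ t) : ramp t = 1 := by
  rw [ramp, min_eq_right h, max_eq_right zero_le_one]

variable {W : Type*} [NormedAddCommGroup W] [InnerProductSpace ℝ W]

/-- The action of the circle on `ℂ × W` by the square of the standard character on `ℂ` and by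
`ρ` on `W`. -/
noncomputable def twist (ρ : Circle →* (W ≃ₗᵢ[ℝ] W)) (u : Circle) : (ℂ × W) →ₗᵢ[ℝ] (ℂ × W) where
  toLinearMap := LinearMap.prodMap (LinearMap.mulLeft ℝ ((u : ℂ) ^ 2)) (ρ u).toLinearEquiv
  norm_map' p := by
    simp [Prod.norm_def, Circle.norm_coe]

@[simp] theorem twist_fst (ρ : Circle →* (W ≃ₗᵢ[ℝ] W)) (u : Circle) (p : ℂ × W) :
    (twist ρ u p).1 = (u : ℂ) ^ 2 * p.1 := rfl

@[simp] theorem twist_snd (ρ : Circle →* (W ≃ₗᵢ[ℝ] W)) (u : Circle) (p : ℂ × W) :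
    (twist ρ u p).2 = ρ u p.2 := rfl

/-- The map `h`, propagated equivariantly to the boundary of the solid torus-like domain
`{‖a‖ ≤ 1} × W`, extends to a nowhere vanishing map at bounded distance from the projection. -/
def ExtendsNonvanishing (ρ : Circle →* (W ≃ₗᵢ[ℝ] W)) (h : W → ℂ × W) : Prop :=
  ∃ F : ℂ × W → ℂ × W, ContinuousOn F {p | ‖p.1‖ ≤ 1} ∧ (∀ p : ℂ × W, ‖p.1‖ ≤ 1 → F p ≠ 0) ∧
    (∃ C, ∀ p : ℂ × W, ‖p.1‖ ≤ 1 → ‖F p - (0, p.2)‖ ≤ C) ∧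
    ∀ (u : Circle) (w : W), F ((u : ℂ), w) = twist ρ u (h (ρ u⁻¹ w))

theorem det_fderiv_sq_prod [FiniteDimensional ℝ W] (p : ℂ × W) :
    (fderiv ℝ (fun p : ℂ × W => (p.1 ^ 2, p.2)) p).det = Complex.normSq (2 * p.1) := by
  have h : HasFDerivAt (fun p : ℂ × W => (p.1 ^ 2, p.2))
      (((2 * p.1) • ContinuousLinearMap.id ℝ ℂ).prodMap (ContinuousLinearMap.id ℝ W)) p := by
    have h1 : HasFDerivAt (fun z : ℂ => z ^ 2) ((2 * p.1) • ContinuousLinearMap.id ℝ ℂ) p.1 := by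
      simpa using (hasFDerivAt_id (𝕜 := ℝ) p.1).pow 2
    exact h1.prodMap p (hasFDerivAt_id p.2)
  rw [h.fderiv, ContinuousLinearMap.det]
  have : ((((2 * p.1) • ContinuousLinearMap.id ℝ ℂ).prodMap (ContinuousLinearMap.id ℝ W) :
      (ℂ × W) →L[ℝ] (ℂ × W)) : (ℂ × W) →ₗ[ℝ] (ℂ × W)) =
      LinearMap.prodMap (LinearMap.mulLeft ℝ (2 * p.1)) LinearMap.id := by
    ext <;> simp [mul_assoc]
  rw [this, LinearMap.det_prodMap, LinearMap.det_id, mul_one, ← Algebra.norm_complex_apply,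
    Algebra.norm_apply]
  rfl

theorem not_extendsNonvanishing_one [FiniteDimensional ℝ W] (ρ : Circle →* (W ≃ₗᵢ[ℝ] W)) :
    ¬ ExtendsNonvanishing ρ fun w => (1, w) := by
  rintro ⟨F, hFc, hF0, ⟨C, hC⟩, hFu⟩
  have hFu' : ∀ (u : Circle) (w : W), F ((u : ℂ), w) = ((u : ℂ) ^ 2, w) := fun u w => by
    rw [hFu]
    ext
    · simp
    · simp
  set M := max C 0
  set G : ℂ × W → ℂ × W := fun p => (p.1 ^ 2, p.2) with hG
  set t : W → ℝ := fun w => ramp (‖w‖ - M) with ht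
  set g : ℂ × W → ℂ × W := fun p => (1 - t p.2) • F (diskProj p.1, p.2) +
    t p.2 • (diskProj p.1 ^ 2, p.2) + (p.1 ^ 2 - diskProj p.1 ^ 2, 0) with hg
  have htc : Continuous t := continuous_ramp.comp (by fun_prop)
  have hFd : Continuous fun p : ℂ × W => F (diskProj p.1, p.2) :=
    hFc.comp_continuous ((continuous_diskProj.comp continuous_fst).prodMk continuous_snd)
      fun p => norm_diskProj_le _
  have hgc : Continuous g := by
    have hd : Continuous fun p : ℂ × W => diskProj p.1 ^ 2 :=
      (continuous_diskProj.comp continuous_fst).pow 2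
    have ht' : Continuous fun p : ℂ × W => t p.2 := htc.comp continuous_snd
    exact (((continuous_const.sub ht').smul hFd).add (ht'.smul (hd.prodMk continuous_snd))).add
      (((continuous_fst.pow 2).sub hd).prodMk continuous_const)
  have hg1 : ∀ p : ℂ × W, 1 ≤ ‖p.1‖ → g p = G p := fun p hp => by
    simp only [hg, hG, diskProj_of_le_norm hp, hFu']
    rw [← add_smul]
    ext <;> simp
  have hg2 : ∀ p : ℂ × W, M + 1 ≤ ‖p.2‖ → g p = G p := fun p hp => by
    have : t p.2 = 1 := ramp_of_one_le (by linarith)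
    simp [hg, hG, this]
  have hM : 0 ≤ M := le_max_right _ _
  obtain ⟨p, hp⟩ := exists_eq_zero_of_eqOn_compl_closedBall (G := G) (g := g) (R := M + 1) (c := 1)
    (by simp only [hG]; fun_prop)
    (fun p => by rw [det_fderiv_sq_prod]; exact Complex.normSq_nonneg _)
    (fun δ hδ => by
      refine ⟨(((min 1 (δ / 2) : ℝ) : ℂ), 0), ?_, ?_⟩
      · have h0 : 0 < min 1 (δ / 2) := by positivity
        have h1 := min_le_left 1 (δ / 2)
        have h2 := min_le_right 1 (δ / 2)
        simp only [hG, Prod.norm_def, norm_pow, Complex.norm_real, norm_zero,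
          Real.norm_of_nonneg h0.le]
        refine max_lt ?_ hδ
        nlinarith
      · rw [det_fderiv_sq_prod, Complex.normSq_pos]
        have h0 : 0 < min 1 (δ / 2) := by positivity
        have : ((min 1 (δ / 2) : ℝ) : ℂ) ≠ 0 := by exact_mod_cast h0.ne'
        simpa using this) one_pos
    (fun p hp => by
      have : M + 1 < ‖p‖ := by simpa using hp
      simp only [hG, Prod.norm_def, lt_max_iff] at this ⊢
      rw [norm_pow]
      rcases this with h | h
      · exact le_max_of_le_left (by nlinarith)
      · exact le_max_of_le_right (by nlinarith)) hgc
    (fun p hp => by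
      have : M + 1 < ‖p‖ := by simpa using hp
      simp only [Prod.norm_def, lt_max_iff] at this
      rcases this with h | h
      · exact hg1 p (by linarith)
      · exact hg2 p h.le)
  by_cases hp1 : 1 ≤ ‖p.1‖
  · rw [hg1 p hp1] at hp
    have : p.1 ^ 2 = 0 := congrArg Prod.fst hp
    rw [sq_eq_zero_iff] at this
    rw [this] at hp1
    norm_num at hp1
  · push Not at hp1
    have hgp : g p = (1 - t p.2) • F p + t p.2 • (p.1 ^ 2, p.2) := by
      simp [hg, diskProj_of_norm_le hp1.le]
    by_cases hw : ‖p.2‖ ≤ M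
    · have : t p.2 = 0 := ramp_of_nonpos (by linarith)
      rw [hgp, this] at hp
      exact hF0 p hp1.le (by simpa using hp)
    · push Not at hw
      have h1 : p.2 = - ((1 - t p.2) • (F p - (0, p.2)).2) := by
        have := congrArg Prod.snd (hgp.symm.trans hp)
        simp only [Prod.snd_add, Prod.smul_snd, Prod.snd_zero] at this
        rw [Prod.snd_sub, smul_sub, neg_sub, sub_eq_add_neg, eq_neg_of_add_eq_zero_left this,
          neg_neg, sub_smul, one_smul]
        abel
      have h2 : ‖p.2‖ ≤ C := by
        rw [h1, norm_neg, norm_smul]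
        have := ramp_nonneg (‖p.2‖ - M)
        have := ramp_le_one (‖p.2‖ - M)
        have h3 : ‖1 - t p.2‖ ≤ 1 := by
          rw [Real.norm_eq_abs, abs_le]; constructor <;> simp only [ht] <;> linarith
        calc _ ≤ 1 * ‖(F p - (0, p.2)).2‖ := by gcongr
          _ ≤ ‖F p - (0, p.2)‖ := by rw [one_mul]; exact norm_snd_le _
          _ ≤ C := hC p hp1.le
      exact absurd (h2.trans (le_max_left C 0)) (not_le.2 hw)

theorem ExtendsNonvanishing.of_segment {ρ : Circle →* (W ≃ₗᵢ[ℝ] W)}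
    (hρ : Continuous fun p : Circle × W => ρ p.1 p.2) {h h₁ : W → ℂ × W}
    (H : ExtendsNonvanishing ρ h) (hc : Continuous h) (hc₁ : Continuous h₁)
    (hseg : ∀ s ∈ Icc (0 : ℝ) 1, ∀ w, (1 - s) • h w + s • h₁ w ≠ 0)
    {C₁ : ℝ} (hC₁ : ∀ w, ‖h₁ w - (0, w)‖ ≤ C₁) : ExtendsNonvanishing ρ h₁ := by
  obtain ⟨F, hFc, hF0, ⟨C, hC⟩, hFu⟩ := H
  have hhC : ∀ w, ‖h w - (0, w)‖ ≤ C := fun w => by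
    have h1 := hC (1, w) (by simp)
    have h2 := hFu 1 w
    simp only [Circle.coe_one, inv_one, map_one] at h2
    rw [h2] at h1
    convert h1 using 2
    ext <;> simp
  set s : ℂ → ℝ := fun a => ramp (2 * ‖a‖ - 1) with hs
  have hsc : Continuous s := continuous_ramp.comp (by fun_prop)
  set B : ℂ × W → ℂ × W := fun p => twist ρ (Complex.phase p.1)
    (h₁ (ρ (Complex.phase p.1)⁻¹ p.2) - h (ρ (Complex.phase p.1)⁻¹ p.2)) with hB
  set F₁ : ℂ × W → ℂ × W := fun p => F (diskProj (2 * p.1), p.2) + s p.1 • B p with hF₁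
  have hF₁in : ∀ p : ℂ × W, ‖p.1‖ ≤ 1 / 2 → F₁ p = F (2 * p.1, p.2) := fun p hp => by
    have h1 : s p.1 = 0 := ramp_of_nonpos (by linarith)
    have h2 : ‖2 * p.1‖ ≤ 1 := by rw [norm_mul, Complex.norm_ofNat]; linarith
    simp [hF₁, h1, diskProj_of_norm_le h2]
  have hphase : ∀ a : ℂ, a ≠ 0 → Complex.phase (2 * a) = Complex.phase a := fun a ha => by
    have := Complex.arg_real_mul a (r := 2) two_pos
    rw [Complex.phase, Complex.phase]
    norm_cast at this ⊢
    rw [this]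
  have hF₁out : ∀ p : ℂ × W, 1 / 2 ≤ ‖p.1‖ → F₁ p = twist ρ (Complex.phase p.1)
      ((1 - s p.1) • h (ρ (Complex.phase p.1)⁻¹ p.2) +
        s p.1 • h₁ (ρ (Complex.phase p.1)⁻¹ p.2)) := fun p hp => by
    have h2 : 1 ≤ ‖2 * p.1‖ := by rw [norm_mul, Complex.norm_ofNat]; linarith
    have h0 : p.1 ≠ 0 := by rw [← norm_pos_iff]; linarith
    simp only [hF₁, diskProj_of_le_norm h2, hphase _ h0, hFu, hB, ← map_smul, ← map_add]
    congr 1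
    module
  have hBn : ∀ p, ‖B p‖ ≤ C₁ + C := fun p => by
    simp only [hB, LinearIsometry.norm_map]
    set w := ρ (Complex.phase p.1)⁻¹ p.2
    have := norm_sub_le (h₁ w - (0, w)) (h w - (0, w))
    rw [sub_sub_sub_cancel_right] at this
    linarith [hC₁ w, hhC w]
  refine ⟨F₁, ?_, fun p hp => ?_, ⟨C + (C₁ + C), fun p hp => ?_⟩, fun u w => ?_⟩
  · refine Continuous.continuousOn (Continuous.add (hFc.comp_continuous
      (((continuous_diskProj.comp (continuous_const.mul continuous_fst))).prodMk continuous_snd)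
      fun p => norm_diskProj_le _) (continuous_iff_continuousAt.2 fun p => ?_))
    by_cases hp : ‖p.1‖ < 1 / 2
    · have : (fun _ => 0) =ᶠ[𝓝 p] fun p => s p.1 • B p := by
        filter_upwards [(isOpen_lt continuous_fst.norm continuous_const).mem_nhds hp] with q hq
        have hq' : ‖q.1‖ < 1 / 2 := hq
        have : s q.1 = 0 := ramp_of_nonpos (by linarith)
        rw [this, zero_smul]
      exact continuousAt_const.congr this
    · have h0 : p.1 ≠ 0 := by rw [← norm_pos_iff]; linarith
      have hph : ContinuousAt (fun p : ℂ × W => Complex.phase p.1) p :=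
        (Complex.continuousAt_phase h0).comp continuousAt_fst
      have hw : ContinuousAt (fun p : ℂ × W => ρ (Complex.phase p.1)⁻¹ p.2) p :=
        hρ.continuousAt.comp (hph.inv.prodMk continuousAt_snd)
      have hd := (hc₁.continuousAt.comp hw).sub (hc.continuousAt.comp hw)
      have hph' : ContinuousAt (fun p : ℂ × W => (Complex.phase p.1 : ℂ) ^ 2) p :=
        (continuous_subtype_val.continuousAt.comp hph).pow 2
      refine (hsc.continuousAt.comp continuousAt_fst).smul (ContinuousAt.prodMk ?_ ?_)
      · exact hph'.mul (continuousAt_fst.comp hd)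
      · exact hρ.continuousAt.comp (hph.prodMk (continuousAt_snd.comp hd))
  · rcases le_total ‖p.1‖ (1 / 2) with h | h
    · rw [hF₁in p h]
      exact hF0 _ (by simp only [norm_mul, Complex.norm_ofNat]; linarith)
    · rw [hF₁out p h, Ne, map_eq_zero_iff _ (LinearIsometry.injective _)]
      exact hseg _ ⟨ramp_nonneg _, ramp_le_one _⟩ _
  · have h1 := hC (diskProj (2 * p.1), p.2) (norm_diskProj_le _)
    have h2 : ‖s p.1 • B p‖ ≤ C₁ + C := by
      rw [norm_smul, Real.norm_of_nonneg (ramp_nonneg _)]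
      exact (mul_le_of_le_one_left (norm_nonneg _) (ramp_le_one _)).trans (hBn p)
    simp only [hF₁]
    rw [add_sub_right_comm]
    exact (norm_add_le _ _).trans (add_le_add h1 h2)
  · have h1 : s (u : ℂ) = 1 := ramp_of_one_le (by rw [Circle.norm_coe]; norm_num)
    rw [hF₁out _ (by simp only [Circle.norm_coe]; norm_num)]
    simp [Complex.phase_coe, h1]

theorem not_extendsNonvanishing_of_eq [FiniteDimensional ℝ W] {ρ : Circle →* (W ≃ₗᵢ[ℝ] W)}
    (hρ : Continuous fun p : Circle × W => ρ p.1 p.2) {h : W → ℂ × W} (hc : Continuous h)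
    (h0 : ∀ w, h w ≠ 0) (hout : ∀ w, 2 ≤ ‖w‖ → h w = (0, w)) : ¬ ExtendsNonvanishing ρ h := by
  intro H
  obtain ⟨d, hd, hdh⟩ : ∃ d > 0, ∀ w, d ≤ ‖h w‖ := by
    obtain ⟨d, hd, hh⟩ := (isCompact_closedBall (0 : W) 2).exists_forall_le'
      (f := fun w => ‖h w‖) hc.norm.continuousOn (a := 0) (fun w _ => norm_pos_iff.2 (h0 w))
    refine ⟨min d 2, by positivity, fun w => ?_⟩
    rcases le_total 2 ‖w‖ with hw | hw
    · rw [hout w hw, Prod.norm_def]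
      exact (min_le_right _ _).trans (hw.trans (le_max_right _ _))
    · exact (min_le_left _ _).trans (hh w (by simpa using hw))
  have hsupp : HasCompactSupport fun w => h w - (0, w) :=
    HasCompactSupport.intro (isCompact_closedBall (0 : W) 2) fun w hw => by
      rw [hout w (by simpa using (not_le.1 (mt mem_closedBall_zero_iff.2 hw)).le), sub_self]
  have hdc : Continuous fun w => h w - (0, w) := hc.sub (by fun_prop)
  obtain ⟨v, hv, hvd⟩ := (hsupp.uniformContinuous_of_continuous hdc).exists_contDiff_dist_le
    (half_pos hd)
  obtain ⟨C, hC⟩ : ∃ C, ∀ w, ‖h w - (0, w)‖ ≤ C := hdc.bounded_above_of_compact_support hsupp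
  set k : W → ℂ × W := fun w => v w + (0, w) with hk
  have hkc : ContDiff ℝ 1 k := (hv.of_le (by norm_cast)).add (by fun_prop)
  have hkh : ∀ w, ‖k w - h w‖ < d / 2 := fun w => by
    have := hvd w
    rw [dist_eq_norm, sub_sub_eq_add_sub] at this
    exact this
  have hkC : ∀ w, ‖k w - (0, w)‖ ≤ d / 2 + C := fun w => by
    rw [← sub_add_sub_cancel _ (h w)]
    exact (norm_add_le _ _).trans (add_le_add (hkh w).le (hC w))
  have Hk : ExtendsNonvanishing ρ k := by
    refine H.of_segment hρ hc hkc.continuous (fun s hs w hw => ?_) hkC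
    have h1 : h w = - (s • (k w - h w)) := by
      rw [eq_neg_iff_add_eq_zero, ← hw]; module
    have h2 : ‖s • (k w - h w)‖ ≤ d / 2 := by
      rw [norm_smul, Real.norm_of_nonneg hs.1]
      exact (mul_le_of_le_one_left (norm_nonneg _) hs.2).trans (hkh w).le
    have h3 := hdh w
    rw [h1, norm_neg] at h3
    linarith
  have hk0 : ∀ w, k w ≠ 0 := fun w hw => by
    have h1 := hkh w
    have h2 := hdh w
    rw [hw, zero_sub, norm_neg] at h1
    linarith
  set Φ : W × ℝ → ℂ × W := fun p => -(Real.exp p.2 • k p.1) - (1, p.1) with hΦ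
  have hΦc : ContDiff ℝ 1 Φ :=
    ((contDiff_snd.exp.smul (hkc.comp contDiff_fst)).neg).sub (contDiff_const.prodMk contDiff_fst)
  have hdense := hΦc.dense_compl_range_of_finrank_lt_finrank (by
    rw [Module.finrank_prod, Module.finrank_prod, Module.finrank_self, Complex.finrank_real_complex]
    omega)
  obtain ⟨y, hy1, hy2⟩ := hdense.exists_mem_open (isOpen_ball (x := (0 : ℂ × W)) (ε := 1 / 2))
    ⟨0, by simp⟩
  have hy : ‖y‖ < 1 / 2 := by simpa using hy2
  have hy' : ‖y.1‖ < 1 / 2 := (norm_fst_le y).trans_lt hy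
  have hre : ∀ s ∈ Icc (0 : ℝ) 1, 0 < (1 + s * y.1.re) := fun s hs => by
    have := abs_le.1 ((Complex.abs_re_le_norm y.1).trans hy'.le)
    nlinarith [hs.1, hs.2]
  have H1 : ExtendsNonvanishing ρ fun w => (1, w) + y := by
    refine Hk.of_segment hρ hkc.continuous (by fun_prop) (fun s hs w hw => ?_)
      (C₁ := 1 + 1 / 2) (fun w => ?_)
    · rcases hs.1.eq_or_lt with rfl | hs0
      · exact hk0 w (by simpa using hw)
      · rcases hs.2.eq_or_lt with rfl | hs1
        · have h1 := congrArg (fun p => p.1.re) hw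
          have h2 := hre 1 (by simp)
          simp at h1
          linarith
        · refine hy1 ⟨(w, Real.log (s⁻¹ * (1 - s))), ?_⟩
          have h1 : 0 < s⁻¹ * (1 - s) := mul_pos (inv_pos.2 hs0) (by linarith)
          simp only [hΦ, Real.exp_log h1]
          have h2 : s⁻¹ • ((1 - s) • k w + s • ((1, w) + y)) = 0 := by rw [hw, smul_zero]
          rw [smul_add, smul_smul, smul_smul, inv_mul_cancel₀ hs0.ne', one_smul, ← add_assoc] at h2
          rw [eq_comm, eq_neg_of_add_eq_zero_right h2]
          abel
    · have : ((1 : ℂ), w) + y - (0, w) = (1, 0) + y := by ext <;> simp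
      rw [this]
      refine (norm_add_le _ _).trans (add_le_add ?_ hy.le)
      simp [Prod.norm_def]
  refine not_extendsNonvanishing_one ρ (H1.of_segment hρ (by fun_prop) (by fun_prop)
    (fun s hs w hw => ?_) (C₁ := 1) (fun w => by simp [Prod.norm_def]))
  have h1 := congrArg (fun p => p.1.re) hw
  have h2 := hre (1 - s) ⟨by linarith [hs.2], by linarith [hs.1]⟩
  simp at h1
  linarith

/-- An equivariant map on `S³ × W` which points outwards for `1 ≤ ‖w‖ ≤ 2` has a zero. -/
theorem exists_eq_zero_of_equivariant [FiniteDimensional ℝ W] {ρ : Circle →* (W ≃ₗᵢ[ℝ] W)}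
    (hρ : Continuous fun p : Circle × W => ρ p.1 p.2)
    {f : EuclideanSpace ℂ (Fin 2) × W → ℂ × W} (hf : Continuous f)
    (hequiv : ∀ (u : Circle) (a : EuclideanSpace ℂ (Fin 2)) (w : W),
      f ((u : ℂ) • a, ρ u w) = twist ρ u (f (a, w)))
    (hpos : ∀ a w, ‖a‖ = 1 → 1 ≤ ‖w‖ → ‖w‖ ≤ 2 → 0 < inner ℝ (f (a, w)).2 w) :
    ∃ a w, ‖a‖ = 1 ∧ ‖w‖ ≤ 1 ∧ f (a, w) = 0 := by
  by_contra! hne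
  set χ : W → ℝ := fun w => ramp (‖w‖ - 1) with hχ
  have hχc : Continuous χ := continuous_ramp.comp (by fun_prop)
  set f' : EuclideanSpace ℂ (Fin 2) × W → ℂ × W :=
    fun p => (1 - χ p.2) • f p + χ p.2 • (0, p.2) with hf'
  have hf'c : Continuous f' := by fun_prop
  have hf'out : ∀ a w, 2 ≤ ‖w‖ → f' (a, w) = (0, w) := fun a w hw => by
    have : χ w = 1 := ramp_of_one_le (by linarith)
    simp [hf', this]
  have hf'0 : ∀ a w, ‖a‖ = 1 → f' (a, w) ≠ 0 := fun a w ha h => by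
    rcases le_total ‖w‖ 1 with hw1 | hw1
    · have : χ w = 0 := ramp_of_nonpos (by linarith)
      refine hne a w ha hw1 ?_
      simpa only [hf', this, sub_zero, one_smul, zero_smul, add_zero] using h
    rcases le_total 2 ‖w‖ with hw2 | hw2
    · rw [hf'out a w hw2] at h
      have : w = 0 := congrArg Prod.snd h
      rw [this, norm_zero] at hw1
      norm_num at hw1
    have h1 : inner ℝ (f' (a, w)).2 w = 0 := by rw [h]; simp
    simp only [hf', Prod.snd_add, Prod.smul_snd, inner_add_left, real_inner_smul_left,
      real_inner_self_eq_norm_sq] at h1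
    have h2 := hpos a w ha hw1 hw2
    have h3 : 0 ≤ χ w := ramp_nonneg _
    have h4 : χ w ≤ 1 := ramp_le_one _
    rcases h3.eq_or_lt with h5 | h5
    · rw [← h5] at h1
      linarith
    · nlinarith [mul_nonneg (sub_nonneg.2 h4) h2.le, mul_pos h5 (show 0 < ‖w‖ ^ 2 by positivity)]
  have hf'e : ∀ (u : Circle) (a : EuclideanSpace ℂ (Fin 2)) (w : W),
      f' ((u : ℂ) • a, ρ u w) = twist ρ u (f' (a, w)) := fun u a w => by
    have : χ (ρ u w) = χ w := by simp only [hχ, LinearIsometryEquiv.norm_map]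
    simp only [hf', this, hequiv, map_add, map_smul]
    congr 2
    ext <;> simp
  set j : ℂ → EuclideanSpace ℂ (Fin 2) := fun a => !₂[a, ((√(1 - ‖a‖ ^ 2) : ℝ) : ℂ)] with hj
  have hjc : Continuous j := by
    refine (PiLp.continuous_toLp 2 _).comp (continuous_pi fun i => ?_)
    fin_cases i
    · exact continuous_id
    · simp; fun_prop
  have hjn : ∀ a, ‖a‖ ≤ 1 → ‖j a‖ = 1 := fun a ha => by
    have : 0 ≤ 1 - ‖a‖ ^ 2 := by nlinarith [norm_nonneg a]
    rw [EuclideanSpace.norm_eq, Fin.sum_univ_two]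
    simp [hj, Real.sq_sqrt this]
  have hju : ∀ u : Circle, j u = (u : ℂ) • j 1 := fun u => by
    ext i
    fin_cases i <;> simp [hj, Circle.norm_coe]
  have hc : Continuous fun p : ℂ × W => f' (j p.1, p.2) :=
    hf'c.comp ((hjc.comp continuous_fst).prodMk continuous_snd)
  refine not_extendsNonvanishing_of_eq hρ (h := fun w => f' (j 1, w)) (by fun_prop)
    (fun w => hf'0 _ w (hjn 1 (by simp))) (fun w => hf'out _ w)
    ⟨fun p => f' (j p.1, p.2), hc.continuousOn, fun p hp => hf'0 _ _ (hjn _ hp), ?_, fun u w => ?_⟩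
  · obtain ⟨C, hC⟩ := ((isCompact_closedBall (0 : ℂ) 1).prod
      (isCompact_closedBall (0 : W) 2)).exists_bound_of_continuousOn
        (f := fun p : ℂ × W => f' (j p.1, p.2) - (0, p.2)) (by fun_prop)
    refine ⟨max C 0, fun p hp => ?_⟩
    rcases le_total 2 ‖p.2‖ with h | h
    · simp [hf'out _ _ h]
    · exact (hC p ⟨by simpa using hp, by simpa using h⟩).trans (le_max_left _ _)
  · rw [← hf'e]
    simp [hju u]

end Equivariant

section Fourier

/-- The complex plane `ℂ²` with its Euclidean norm. -/
abbrev ComplexPlane := EuclideanSpace ℂ (Fin 2)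

theorem inner_smul_left_conj (ζ : ℂ) (x y : ComplexPlane) :
    inner ℝ (ζ • x) y = inner ℝ x ((starRingEnd ℂ ζ) • y) := by
  simp [PiLp.inner_apply, Fin.sum_univ_two]
  ring

theorem inner_I_smul_self (r : ℝ) (x : ComplexPlane) :
    inner ℝ x ((Complex.I * (r : ℂ)) • x) = 0 := by
  simp [PiLp.inner_apply, Fin.sum_univ_two]
  ring

variable {V : Type*} [NormedAddCommGroup V] [NormedSpace ℂ V]

theorem integrable_haarAddCircle {V : Type*} [NormedAddCommGroup V] {u : UnitAddCircle → V}
    (hu : Continuous u) : Integrable u AddCircle.haarAddCircle :=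
  hu.integrable_of_hasCompactSupport (HasCompactSupport.of_compactSpace _)

theorem integrable_fourier_smul {u : UnitAddCircle → V} (hu : Continuous u) (n : ℤ) :
    Integrable (fun t => fourier n t • u t) AddCircle.haarAddCircle :=
  integrable_haarAddCircle ((fourier n).continuous.smul hu)

theorem norm_fourier_apply (n : ℤ) (t : UnitAddCircle) : ‖(fourier n t : ℂ)‖ = 1 := by
  rw [fourier_apply, Circle.norm_coe]

theorem fourierCoeff_comp_add_right (u : UnitAddCircle → V) (τ : UnitAddCircle) (n : ℤ) :
    fourierCoeff (fun t => u (t + τ)) n = (fourier n τ : ℂ) • fourierCoeff u n := by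
  have h : ∀ t, fourier (-n) t • u (t + τ) =
      (fun t => (fourier n τ : ℂ) • fourier (-n) t • u t) (t + τ) := fun t => by
    simp only [smul_smul, fourier_apply, smul_add, AddCircle.toCircle_add, Circle.coe_mul,
      neg_smul, AddCircle.toCircle_neg]
    rw [mul_left_comm, ← Circle.coe_mul, mul_inv_cancel, Circle.coe_one, mul_one]
  rw [fourierCoeff, fourierCoeff, integral_congr_ae (ae_of_all _ h),
    integral_add_right_eq_self (μ := AddCircle.haarAddCircle)
      (fun t => (fourier n τ : ℂ) • fourier (-n) t • u t) τ, integral_smul]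

theorem integral_inner_fourier_smul {u : UnitAddCircle → ComplexPlane} (hu : Continuous u) (n : ℤ)
    (c : ComplexPlane) : ∫ t, inner ℝ (fourier n t • c) (u t) ∂AddCircle.haarAddCircle =
      inner ℝ c (fourierCoeff u n) := by
  rw [fourierCoeff, ← integral_inner (integrable_fourier_smul hu _)]
  refine integral_congr_ae (ae_of_all _ fun t => ?_)
  simp only [inner_smul_left_conj, fourier_neg]

/-- The trigonometric polynomial with frequencies in `J` and coefficients `c`. -/
noncomputable def trigPoly (J : Finset ℤ) (c : ℤ → V) (t : UnitAddCircle) : V :=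
  ∑ k ∈ J, fourier k t • c k

theorem continuous_trigPoly (J : Finset ℤ) (c : ℤ → V) : Continuous (trigPoly J c) := by
  unfold trigPoly
  fun_prop

theorem fourierCoeff_trigPoly [CompleteSpace V] (J : Finset ℤ) (c : ℤ → V) (n : ℤ) :
    fourierCoeff (trigPoly J c) n = if n ∈ J then c n else 0 := by
  have h : ∀ k, fourierCoeff (fun t : UnitAddCircle => fourier k t • c k) n =
      if n = k then c k else 0 := fun k => by
    simp only [fourierCoeff, ← smul_assoc]
    rw [integral_smul_const]
    have := congrFun (fourierCoeff_fourier (T := 1) k) n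
    rw [fourierCoeff] at this
    rw [this, Pi.single_apply]
    split_ifs <;> simp
  have h2 : trigPoly J c = ∑ k ∈ J, fun t => fourier k t • c k := by
    funext t; simp [trigPoly]
  rw [h2, fourierCoeff.sum, Finset.sum_apply, Finset.sum_congr rfl fun k _ => h k, Finset.sum_ite_eq]
  exact fun k _ => integrable_haarAddCircle (by fun_prop)

theorem integral_inner_trigPoly (J : Finset ℤ) (c : ℤ → ComplexPlane)
    {u : UnitAddCircle → ComplexPlane} (hu : Continuous u) :
    ∫ t, inner ℝ (trigPoly J c t) (u t) ∂AddCircle.haarAddCircle =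
      ∑ k ∈ J, inner ℝ (c k) (fourierCoeff u k) := by
  simp only [trigPoly, sum_inner]
  rw [integral_finsetSum]
  · simp only [integral_inner_fourier_smul hu]
  · exact fun k _ => integrable_haarAddCircle (by fun_prop)

theorem integral_norm_sq_trigPoly (J : Finset ℤ) (c : ℤ → ComplexPlane) :
    ∫ t, ‖trigPoly J c t‖ ^ 2 ∂AddCircle.haarAddCircle = ∑ k ∈ J, ‖c k‖ ^ 2 := by
  simp only [← real_inner_self_eq_norm_sq]
  rw [integral_inner_trigPoly J c (continuous_trigPoly J c)]
  exact Finset.sum_congr rfl fun k hk => by rw [fourierCoeff_trigPoly, if_pos hk]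

theorem sum_norm_sq_fourierCoeff_le (J : Finset ℤ) {u : UnitAddCircle → ComplexPlane}
    (hu : Continuous u) :
    ∑ k ∈ J, ‖fourierCoeff u k‖ ^ 2 ≤ ∫ t, ‖u t‖ ^ 2 ∂AddCircle.haarAddCircle := by
  have h1 := integral_inner_trigPoly J (fourierCoeff u) hu
  have h2 := integral_norm_sq_trigPoly J (fourierCoeff u)
  have h3 : 0 ≤ ∫ t, ‖u t - trigPoly J (fourierCoeff u) t‖ ^ 2 ∂AddCircle.haarAddCircle :=
    integral_nonneg fun t => by positivity
  have hc := continuous_trigPoly J (fourierCoeff u)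
  simp only [norm_sub_sq_real] at h3
  rw [integral_add (integrable_haarAddCircle (by fun_prop)) (integrable_haarAddCircle (by fun_prop)),
    integral_sub (integrable_haarAddCircle (by fun_prop)) (integrable_haarAddCircle (by fun_prop)),
    integral_const_mul, h2] at h3
  simp only [real_inner_comm (trigPoly J _ _)] at h3
  rw [h1] at h3
  simp only [real_inner_self_eq_norm_sq] at h3
  linarith

end Fourier

section Galerkin

/-- Multiplication by a complex number of modulus one, as a real-linear isometry of `ℂ²`. -/
noncomputable def circleIsometry : Circle →* (ComplexPlane ≃ₗᵢ[ℝ] ComplexPlane) where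
  toFun u :=
    { toFun := fun x => (u : ℂ) • x
      invFun := fun x => ((u⁻¹ : Circle) : ℂ) • x
      map_add' := fun x y => smul_add _ x y
      map_smul' := fun r x => smul_comm _ _ _
      left_inv := fun x => by
        change ((u⁻¹ : Circle) : ℂ) • (u : ℂ) • x = x
        rw [smul_smul, ← Circle.coe_mul, inv_mul_cancel, Circle.coe_one, one_smul]
      right_inv := fun x => by
        change (u : ℂ) • ((u⁻¹ : Circle) : ℂ) • x = x
        rw [smul_smul, ← Circle.coe_mul, mul_inv_cancel, Circle.coe_one, one_smul]
      norm_map' := fun x => by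
        change ‖(u : ℂ) • x‖ = ‖x‖
        rw [norm_smul, Circle.norm_coe, one_mul] }
  map_one' := by ext1 x; exact one_smul ℂ x
  map_mul' u v := by ext1 x; exact mul_smul (u : ℂ) (v : ℂ) x

@[simp] theorem circleIsometry_apply (u : Circle) (x : ComplexPlane) :
    circleIsometry u x = (u : ℂ) • x := rfl

/-- Families of Fourier coefficients in `ℂ²` indexed by a finite set of frequencies. -/
abbrev Modes (K : Finset ℤ) := PiLp 2 fun _ : K => ComplexPlane

/-- The action of the circle on Fourier coefficients induced by translations of the circle. -/
noncomputable def modesAction (K : Finset ℤ) : Circle →* (Modes K ≃ₗᵢ[ℝ] Modes K) where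
  toFun u := LinearIsometryEquiv.piLpCongrRight 2 fun k : K => circleIsometry (u ^ (k : ℤ))
  map_one' := by ext1 w; simp
  map_mul' u v := by
    ext1 w
    refine PiLp.ext fun k => ?_
    simp [mul_zpow]

@[simp] theorem modesAction_apply (K : Finset ℤ) (u : Circle) (w : Modes K) (k : K) :
    modesAction K u w k = ((u ^ (k : ℤ) : Circle) : ℂ) • w k := rfl

theorem continuous_modesAction (K : Finset ℤ) :
    Continuous fun p : Circle × Modes K => modesAction K p.1 p.2 := by
  refine (PiLp.continuous_toLp 2 _).comp (continuous_pi fun k => ?_)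
  have h1 : Continuous fun p : Circle × Modes K => ((p.1 ^ (k : ℤ) : Circle) : ℂ) :=
    continuous_induced_dom.comp
      (continuous_fst.zpow (k : ℤ) : Continuous fun p : Circle × Modes K => p.1 ^ (k : ℤ))
  have h2 : Continuous fun p : Circle × Modes K => p.2 k := by fun_prop
  exact h1.smul h2

/-- The coefficient sequence with value `a` at frequency one and `w` on `K`. -/
noncomputable def modeCoeff {K : Finset ℤ} (a : ComplexPlane) (w : Modes K) (k : ℤ) :
    ComplexPlane :=
  if k = 1 then a else if h : k ∈ K then w ⟨k, h⟩ else 0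

variable {K : Finset ℤ}

theorem modeCoeff_one (a : ComplexPlane) (w : Modes K) : modeCoeff a w 1 = a := if_pos rfl

theorem modeCoeff_coe (hK : 1 ∉ K) (a : ComplexPlane) (w : Modes K) (k : K) :
    modeCoeff a w k = w k := by
  have : (k : ℤ) ≠ 1 := fun h => hK (h ▸ k.2)
  simp [modeCoeff, this]

theorem continuous_modeCoeff (k : ℤ) :
    Continuous fun p : ComplexPlane × Modes K => modeCoeff p.1 p.2 k := by
  unfold modeCoeff
  split_ifs <;> fun_prop

theorem modeCoeff_smul (u : Circle) (a : ComplexPlane) (w : Modes K) (k : ℤ) :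
    modeCoeff ((u : ℂ) • a) (modesAction K u w) k =
      ((u ^ k : Circle) : ℂ) • modeCoeff a w k := by
  unfold modeCoeff
  split_ifs with h1 h2
  · simp [h1]
  · simp
  · simp

theorem sum_insert_modes {β : Type*} [AddCommMonoid β] (hK : 1 ∉ K) (a : ComplexPlane)
    (w : Modes K) (φ : ℤ → ComplexPlane → β) :
    ∑ k ∈ insert 1 K, φ k (modeCoeff a w k) = φ 1 a + ∑ k : K, φ k (w k) := by
  rw [Finset.sum_insert hK, modeCoeff_one, ← Finset.sum_coe_sort K]
  simp only [modeCoeff_coe hK]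

/-- The trigonometric polynomial with coefficient `a` at frequency one and `w` on `K`. -/
noncomputable def modePoly (a : ComplexPlane) (w : Modes K) : UnitAddCircle → ComplexPlane :=
  trigPoly (insert 1 K) (modeCoeff a w)

theorem continuous_modePoly (a : ComplexPlane) (w : Modes K) : Continuous (modePoly a w) :=
  continuous_trigPoly _ _

theorem continuous_uncurry_modePoly :
    Continuous fun p : (ComplexPlane × Modes K) × UnitAddCircle => modePoly p.1.1 p.1.2 p.2 := by
  unfold modePoly trigPoly
  refine continuous_finsetSum _ fun k _ => ?_
  exact ((fourier k).continuous.comp continuous_snd).smul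
    ((continuous_modeCoeff k).comp continuous_fst)

theorem modePoly_smul (τ : UnitAddCircle) (a : ComplexPlane) (w : Modes K) (t : UnitAddCircle) :
    modePoly ((AddCircle.toCircle τ : ℂ) • a) (modesAction K (AddCircle.toCircle τ) w) t =
      modePoly a w (t + τ) := by
  unfold modePoly trigPoly
  refine Finset.sum_congr rfl fun k _ => ?_
  rw [modeCoeff_smul, smul_smul, fourier_apply, fourier_apply, smul_add, AddCircle.toCircle_add,
    Circle.coe_mul, AddCircle.toCircle_zsmul τ]

theorem integral_norm_sq_modePoly (hK : 1 ∉ K) (a : ComplexPlane) (w : Modes K) :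
    ∫ t, ‖modePoly a w t‖ ^ 2 ∂AddCircle.haarAddCircle = ‖a‖ ^ 2 + ‖w‖ ^ 2 := by
  rw [modePoly, integral_norm_sq_trigPoly, sum_insert_modes hK a w fun _ x => ‖x‖ ^ 2,
    PiLp.norm_sq_eq_of_L2 _ w]

variable {E : ComplexPlane → ComplexPlane}

/-- The Fourier coefficients of the perturbation along a trigonometric polynomial. -/
noncomputable def pertCoeff (E : ComplexPlane → ComplexPlane) (a : ComplexPlane) (w : Modes K)
    (k : ℤ) : ComplexPlane :=
  fourierCoeff (fun t => E (modePoly a w t)) k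

theorem continuous_pertCoeff (hE : Continuous E) (k : ℤ) :
    Continuous fun p : ComplexPlane × Modes K => pertCoeff E p.1 p.2 k := by
  unfold pertCoeff fourierCoeff
  have h : Continuous (uncurry fun (p : ComplexPlane × Modes K) (t : UnitAddCircle) =>
      (fourier (-k) t : ℂ) • E (modePoly p.1 p.2 t)) :=
    ((fourier (-k)).continuous.comp continuous_snd).smul (hE.comp continuous_uncurry_modePoly)
  have := continuous_parametric_integral_of_continuous (μ := AddCircle.haarAddCircle) h
    (isCompact_univ (X := UnitAddCircle))
  simpa using this

theorem pertCoeff_smul (u : Circle) (a : ComplexPlane) (w : Modes K) (k : ℤ) :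
    pertCoeff E ((u : ℂ) • a) (modesAction K u w) k =
      ((u ^ k : Circle) : ℂ) • pertCoeff E a w k := by
  obtain ⟨τ, rfl⟩ : ∃ τ : UnitAddCircle, AddCircle.toCircle τ = u :=
    ⟨(AddCircle.homeomorphCircle one_ne_zero).symm u, by
      rw [← AddCircle.homeomorphCircle_apply one_ne_zero, Homeomorph.apply_symm_apply]⟩
  unfold pertCoeff
  simp only [modePoly_smul]
  rw [fourierCoeff_comp_add_right (fun t => E (modePoly a w t)), fourier_apply,
    AddCircle.toCircle_zsmul]

theorem sum_norm_sq_fourierCoeff_comp_le (hE : Continuous E) {ε : ℝ}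
    (hEε : ∀ p, ‖E p‖ ≤ ε * ‖p‖) {z : UnitAddCircle → ComplexPlane} (hz : Continuous z)
    (J : Finset ℤ) :
    ∑ k ∈ J, ‖fourierCoeff (fun t => E (z t)) k‖ ^ 2 ≤
      ε ^ 2 * ∫ t, ‖z t‖ ^ 2 ∂AddCircle.haarAddCircle := by
  refine (sum_norm_sq_fourierCoeff_le J (hE.comp hz)).trans ?_
  rw [← integral_const_mul]
  refine integral_mono (integrable_haarAddCircle (by fun_prop))
    (integrable_haarAddCircle (by fun_prop)) fun t => ?_
  simp only [Function.comp, ← mul_pow]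
  exact pow_le_pow_left₀ (norm_nonneg _) (hEε _) 2

/-- The deviation from one of the angular speed that solves the radial part of the equation at
frequency one. -/
noncomputable def speedShift (E : ComplexPlane → ComplexPlane) (a : ComplexPlane) (w : Modes K) :
    ℝ :=
  inner ℝ (Complex.I • a) (pertCoeff E a w 1)

/-- The map whose zeros are the solutions of the Galerkin equations with frequencies
`insert 1 K`. -/
noncomputable def galerkinMap (E : ComplexPlane → ComplexPlane)
    (p : ComplexPlane × Modes K) : ℂ × Modes K :=
  (p.1 0 * pertCoeff E p.1 p.2 1 1 - p.1 1 * pertCoeff E p.1 p.2 1 0,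
    WithLp.toLp 2 fun k : K => p.2 k + (Complex.I * ((k : ℂ) - 1))⁻¹ •
      ((Complex.I * (speedShift E p.1 p.2 * (k : ℂ))) • p.2 k - pertCoeff E p.1 p.2 k))

theorem continuous_galerkinMap (hE : Continuous E) :
    Continuous (galerkinMap E : ComplexPlane × Modes K → ℂ × Modes K) := by
  have h := fun k => continuous_pertCoeff (K := K) hE k
  have h0 : Continuous fun p : ComplexPlane × Modes K => Complex.I • p.1 :=
    (continuous_const_smul Complex.I).comp continuous_fst
  have h1 : Continuous fun p : ComplexPlane × Modes K => speedShift E p.1 p.2 :=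
    Continuous.inner h0 (h 1)
  refine Continuous.prodMk ?_ ?_
  · have h2 := fun i => (PiLp.continuous_apply 2 (fun _ : Fin 2 => ℂ) i).comp (h 1)
    have h3 := fun i => (PiLp.continuous_apply 2 (fun _ : Fin 2 => ℂ) i).comp
      (continuous_fst : Continuous fun p : ComplexPlane × Modes K => p.1)
    exact ((h3 0).mul (h2 1)).sub ((h3 1).mul (h2 0))
  · refine (PiLp.continuous_toLp 2 _).comp (continuous_pi fun k => ?_)
    have h2 : Continuous fun p : ComplexPlane × Modes K => p.2 k :=
      (PiLp.continuous_apply 2 (fun _ : K => ComplexPlane) k).comp continuous_snd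
    have h3 : Continuous fun p : ComplexPlane × Modes K =>
        Complex.I * ((speedShift E p.1 p.2 : ℂ) * (k : ℂ)) :=
      continuous_const.mul ((Complex.continuous_ofReal.comp h1).mul continuous_const)
    have h4 : Continuous fun p : ComplexPlane × Modes K =>
        (Complex.I * ((speedShift E p.1 p.2 : ℂ) * (k : ℂ))) • p.2 k - pertCoeff E p.1 p.2 k :=
      (h3.smul h2).sub (h k)
    have h5 : Continuous fun p : ComplexPlane × Modes K => (Complex.I * ((k : ℂ) - 1))⁻¹ •
        ((Complex.I * ((speedShift E p.1 p.2 : ℂ) * (k : ℂ))) • p.2 k - pertCoeff E p.1 p.2 k) :=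
      (continuous_const_smul (Complex.I * ((k : ℂ) - 1))⁻¹).comp h4
    exact h2.add h5

theorem speedShift_smul (u : Circle) (a : ComplexPlane) (w : Modes K) :
    speedShift E ((u : ℂ) • a) (modesAction K u w) = speedShift E a w := by
  rw [speedShift, speedShift, pertCoeff_smul u, zpow_one, smul_comm,
    ← circleIsometry_apply, ← circleIsometry_apply, LinearIsometryEquiv.inner_map_map]

theorem galerkinMap_smul (u : Circle) (a : ComplexPlane) (w : Modes K) :
    galerkinMap E ((u : ℂ) • a, modesAction K u w) =
      twist (modesAction K) u (galerkinMap E (a, w)) := by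
  refine Prod.ext ?_ (PiLp.ext fun k => ?_)
  · simp only [galerkinMap, pertCoeff_smul u, zpow_one, twist_fst, PiLp.smul_apply, smul_eq_mul]
    ring
  · simp only [galerkinMap, pertCoeff_smul u, twist_snd, speedShift_smul u,
      modesAction_apply]
    module

theorem inner_mode_ge {k : ℤ} (hk : k ≠ 1) {m : ℝ} (hm : |m| ≤ 1 / 4) (x e : ComplexPlane) :
    ‖x‖ ^ 2 / 2 - ‖e‖ * ‖x‖ ≤
      inner ℝ (x + (Complex.I * ((k : ℂ) - 1))⁻¹ • ((Complex.I * (m * (k : ℂ))) • x - e)) x := by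
  have hk1 : 1 ≤ |((k : ℝ) - 1)| := by
    have : 1 ≤ |k - 1| := Int.one_le_abs (sub_ne_zero.2 hk)
    exact_mod_cast this
  have hk0 : (k : ℝ) - 1 ≠ 0 := by
    intro h; rw [h, abs_zero] at hk1; linarith
  have hk0' : (k : ℂ) - 1 ≠ 0 := by exact_mod_cast hk0
  set r : ℝ := m * (k / (k - 1)) with hr
  have hr2 : |r| ≤ 1 / 2 := by
    rw [hr, abs_mul]
    have : |(k : ℝ) / (k - 1)| ≤ 2 := by
      rw [abs_div, div_le_iff₀ (by linarith)]
      have h1 := abs_add_le ((k : ℝ) - 1) 1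
      rw [sub_add_cancel, abs_one] at h1
      linarith
    nlinarith [abs_nonneg m, abs_nonneg ((k : ℝ) / (k - 1))]
  have h1 : (Complex.I * ((k : ℂ) - 1))⁻¹ • (Complex.I * (m * (k : ℂ))) • x = r • x := by
    have : (Complex.I * ((k : ℂ) - 1))⁻¹ * (Complex.I * (m * (k : ℂ))) = (r : ℂ) := by
      rw [hr]; push_cast; field_simp
    rw [smul_smul, this]
    exact Complex.coe_smul r x
  have h2 : ‖(Complex.I * ((k : ℂ) - 1))⁻¹ • e‖ ≤ ‖e‖ := by
    have h3 : 1 ≤ ‖(k : ℂ) - 1‖ := by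
      have : (k : ℂ) - 1 = (((k : ℝ) - 1 : ℝ) : ℂ) := by push_cast; rfl
      rw [this, Complex.norm_real]
      exact hk1
    rw [norm_smul, norm_inv, norm_mul, Complex.norm_I, one_mul]
    exact mul_le_of_le_one_left (norm_nonneg _) (inv_le_one_of_one_le₀ h3)
  rw [smul_sub, h1, inner_add_left, inner_sub_left, real_inner_smul_left,
    real_inner_self_eq_norm_sq]
  have h4 := (real_inner_le_norm ((Complex.I * ((k : ℂ) - 1))⁻¹ • e) x).trans
    (mul_le_mul_of_nonneg_right h2 (norm_nonneg _))
  nlinarith [(abs_le.1 hr2).1, sq_nonneg ‖x‖]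

theorem norm_sq_pertCoeff_le (hK : 1 ∉ K) (hE : Continuous E)
    (hEε : ∀ p, ‖E p‖ ≤ 1 / 10 * ‖p‖) {a : ComplexPlane} {w : Modes K} (ha : ‖a‖ = 1)
    (hw : ‖w‖ ≤ 2) :
    ‖pertCoeff E a w 1‖ ^ 2 + ∑ k : K, ‖pertCoeff E a w k‖ ^ 2 ≤ 1 / 16 := by
  have h := sum_norm_sq_fourierCoeff_comp_le hE hEε (continuous_modePoly a w) (insert 1 K)
  rw [integral_norm_sq_modePoly hK, ha, Finset.sum_insert hK, ← Finset.sum_coe_sort K] at h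
  refine h.trans ?_
  nlinarith [norm_nonneg w]

theorem abs_speedShift_le (hK : 1 ∉ K) (hE : Continuous E)
    (hEε : ∀ p, ‖E p‖ ≤ 1 / 10 * ‖p‖) {a : ComplexPlane} {w : Modes K} (ha : ‖a‖ = 1)
    (hw : ‖w‖ ≤ 2) : |speedShift E a w| ≤ 1 / 4 := by
  have h := norm_sq_pertCoeff_le hK hE hEε ha hw
  have h1 : 0 ≤ ∑ k : K, ‖pertCoeff E a w k‖ ^ 2 := Finset.sum_nonneg fun k _ => sq_nonneg _
  have h2 : ‖pertCoeff E a w 1‖ ≤ 1 / 4 := by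
    nlinarith [norm_nonneg (pertCoeff E a w 1)]
  have h3 := abs_real_inner_le_norm (Complex.I • a) (pertCoeff E a w 1)
  rw [norm_smul, Complex.norm_I, ha, one_mul, one_mul] at h3
  exact h3.trans h2

theorem inner_galerkinMap_pos (hK : 1 ∉ K) (hE : Continuous E)
    (hEε : ∀ p, ‖E p‖ ≤ 1 / 10 * ‖p‖) {a : ComplexPlane} {w : Modes K} (ha : ‖a‖ = 1)
    (hw₁ : 1 ≤ ‖w‖) (hw₂ : ‖w‖ ≤ 2) : 0 < inner ℝ (galerkinMap E (a, w)).2 w := by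
  have h := norm_sq_pertCoeff_le hK hE hEε ha hw₂
  have h1 : ∀ k : K, ‖w k‖ ^ 2 / 4 - ‖pertCoeff E a w k‖ ^ 2 ≤
      inner ℝ ((galerkinMap E (a, w)).2 k) (w k) := fun k => by
    have hk : (k : ℤ) ≠ 1 := fun h => hK (h ▸ k.2)
    refine le_trans ?_ (inner_mode_ge hk (abs_speedShift_le hK hE hEε ha hw₂) (w k)
      (pertCoeff E a w k))
    nlinarith [sq_nonneg (‖w k‖ / 2 - ‖pertCoeff E a w k‖)]
  rw [PiLp.inner_apply]
  refine lt_of_lt_of_le ?_ (Finset.sum_le_sum fun k _ => h1 k)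
  rw [Finset.sum_sub_distrib, ← Finset.sum_div, ← PiLp.norm_sq_eq_of_L2]
  nlinarith [sq_nonneg ‖pertCoeff E a w 1‖]

theorem smul_eq_of_det_eq_zero {a b : ComplexPlane} (ha : ‖a‖ = 1)
    (h : a 0 * b 1 - a 1 * b 0 = 0) (hr : inner ℝ a b = 0) :
    (Complex.I * (inner ℝ (Complex.I • a) b : ℝ)) • a = b := by
  have h1 : inner ℂ a b = Complex.I * (inner ℝ (Complex.I • a) b : ℝ) := by
    have e1 : (inner ℂ a b).re = 0 := hr
    have e2 : inner ℝ (Complex.I • a) b = (inner ℂ (Complex.I • a) b).re := rfl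
    rw [e2, inner_smul_left]
    apply Complex.ext <;> simp [e1]
  have h2 : (starRingEnd ℂ) (a 0) * a 0 + (starRingEnd ℂ) (a 1) * a 1 = 1 := by
    have := inner_self_eq_norm_sq_to_K (𝕜 := ℂ) a
    rw [ha, PiLp.inner_apply, Fin.sum_univ_two] at this
    simp only [RCLike.inner_apply] at this
    rw [mul_comm, mul_comm _ (a 1), this]
    simp
  rw [← h1, PiLp.inner_apply, Fin.sum_univ_two]
  simp only [RCLike.inner_apply]
  refine PiLp.ext fun i => ?_
  fin_cases i
  · change (b 0 * (starRingEnd ℂ) (a 0) + b 1 * (starRingEnd ℂ) (a 1)) * a 0 = b 0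
    linear_combination b 0 * h2 + (starRingEnd ℂ) (a 1) * h
  · change (b 0 * (starRingEnd ℂ) (a 0) + b 1 * (starRingEnd ℂ) (a 1)) * a 1 = b 1
    linear_combination b 1 * h2 - (starRingEnd ℂ) (a 0) * h

/-- Solvability of the Galerkin equations. -/
theorem exists_galerkin_solution (hK : 1 ∉ K) (hE : Continuous E)
    (hEε : ∀ p, ‖E p‖ ≤ 1 / 10 * ‖p‖) (hE0 : ∀ p, inner ℝ p (E p) = 0) :
    ∃ (c : ℤ → ComplexPlane) (m : ℝ), |m| ≤ 1 / 4 ∧ ‖c 1‖ = 1 ∧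
      ∑ k ∈ insert 1 K, ‖c k‖ ^ 2 ≤ 2 ∧ ∀ k ∈ insert 1 K, (Complex.I * ((1 + m) * k - 1)) • c k =
        fourierCoeff (fun t => E (trigPoly (insert 1 K) c t)) k := by
  obtain ⟨a, w, ha, hw, hz⟩ := exists_eq_zero_of_equivariant (continuous_modesAction K)
    (continuous_galerkinMap hE) (fun u a w => galerkinMap_smul u a w)
    (fun a w ha hw₁ hw₂ => inner_galerkinMap_pos hK hE hEε ha hw₁ hw₂)
  set m := speedShift E a w
  have hk : ∀ k : K, (Complex.I * ((1 + m) * (k : ℤ) - 1)) • w k = pertCoeff E a w k := by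
    intro k
    have hk1 : Complex.I * (((k : ℤ) : ℂ) - 1) ≠ 0 := by
      have h0 : (k : ℤ) ≠ 1 := fun h => hK (h ▸ k.2)
      have : ((k : ℤ) : ℂ) ≠ 1 := by exact_mod_cast h0
      exact mul_ne_zero Complex.I_ne_zero (sub_ne_zero.2 this)
    have h1 : w k + (Complex.I * (((k : ℤ) : ℂ) - 1))⁻¹ •
        ((Complex.I * (m * ((k : ℤ) : ℂ))) • w k - pertCoeff E a w k) = 0 :=
      congrArg (fun p : ℂ × Modes K => p.2 k) hz
    have h2 := congrArg (fun x => (Complex.I * (((k : ℤ) : ℂ) - 1)) • x) h1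
    simp only [smul_add, smul_zero, smul_inv_smul₀ hk1] at h2
    rw [← sub_eq_zero, ← h2]
    module
  have hsum : inner ℝ a (pertCoeff E a w 1) = 0 := by
    have h1 : ∫ t, inner ℝ (modePoly a w t) (E (modePoly a w t)) ∂AddCircle.haarAddCircle = 0 := by
      simp [hE0]
    have h2 := (integral_inner_trigPoly (insert 1 K) (modeCoeff a w)
      (hE.comp (continuous_modePoly a w))).symm.trans h1
    rw [sum_insert_modes hK a w fun k x =>
      (inner ℝ x (fourierCoeff (E ∘ modePoly a w) k) : ℝ)] at h2
    have h3 : ∀ k : K, inner ℝ (w k) (pertCoeff E a w k) = 0 := fun k => by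
      rw [← hk k]
      have := inner_I_smul_self ((1 + m) * (k : ℤ) - 1) (w k)
      push_cast at this
      exact this
    have h4 : ∑ k : K, inner ℝ (w k) (pertCoeff E a w k) = 0 := Finset.sum_eq_zero fun k _ => h3 k
    have h5 : inner ℝ a (pertCoeff E a w 1) + ∑ k : K, inner ℝ (w k) (pertCoeff E a w k) = 0 := h2
    rwa [h4, add_zero] at h5
  refine ⟨modeCoeff a w, m, abs_speedShift_le hK hE hEε ha (hw.trans one_le_two), ?_, ?_, ?_⟩
  · rw [modeCoeff_one, ha]
  · rw [sum_insert_modes hK a w fun _ x => ‖x‖ ^ 2, ← PiLp.norm_sq_eq_of_L2, ha]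
    nlinarith [norm_nonneg w]
  · intro k hk'
    rcases Finset.mem_insert.1 hk' with rfl | hkK
    · rw [modeCoeff_one]
      have := smul_eq_of_det_eq_zero ha (congrArg Prod.fst hz) hsum
      rw [show fourierCoeff (fun t => E (trigPoly (insert 1 K) (modeCoeff a w) t)) 1 =
        pertCoeff E a w 1 from rfl, ← this]
      congr 1
      simp [m, speedShift]
    · have := hk ⟨k, hkK⟩
      rw [← modeCoeff_coe hK a] at this
      exact this

end Galerkin

section Limit

theorem summable_inv_one_add_int_sq : Summable fun k : ℤ => (1 + (k : ℝ) ^ 2)⁻¹ := by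
  refine Summable.of_nonneg_of_le (fun k => by positivity) (fun k => ?_)
    ((Real.summable_one_div_int_pow.2 one_lt_two).add (hasSum_ite_eq (0 : ℤ) (1 : ℝ)).summable)
  rcases eq_or_ne k 0 with rfl | hk
  · simp
  · have : (0 : ℝ) < (k : ℝ) ^ 2 := by positivity
    rw [if_neg hk, add_zero, one_div]
    exact inv_anti₀ this (by linarith)

/-- The modulus of continuity controlling functions with weighted square-summable Fourier
coefficients. -/
noncomputable def fourierModulus (h : UnitAddCircle) : ℝ :=
  ∑' k : ℤ, ‖(fourier k h : ℂ) - 1‖ ^ 2 * (1 + (k : ℝ) ^ 2)⁻¹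

theorem fourierModulus_term_le (k : ℤ) (h : UnitAddCircle) :
    ‖(fourier k h : ℂ) - 1‖ ^ 2 * (1 + (k : ℝ) ^ 2)⁻¹ ≤ 4 * (1 + (k : ℝ) ^ 2)⁻¹ := by
  have h1 : ‖(fourier k h : ℂ) - 1‖ ≤ 2 := by
    refine (norm_sub_le _ _).trans ?_
    rw [norm_fourier_apply, norm_one]
    norm_num
  have h2 : ‖(fourier k h : ℂ) - 1‖ ^ 2 ≤ 4 := by nlinarith [norm_nonneg ((fourier k h : ℂ) - 1)]
  exact mul_le_mul_of_nonneg_right h2 (by positivity)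

theorem summable_fourierModulus (h : UnitAddCircle) :
    Summable fun k : ℤ => ‖(fourier k h : ℂ) - 1‖ ^ 2 * (1 + (k : ℝ) ^ 2)⁻¹ :=
  Summable.of_nonneg_of_le (fun k => by positivity) (fun k => fourierModulus_term_le k h)
    (summable_inv_one_add_int_sq.mul_left 4)

theorem continuous_fourierModulus : Continuous fourierModulus := by
  refine continuous_tsum (fun k => ?_) (summable_inv_one_add_int_sq.mul_left 4) fun k h => ?_
  · exact (((fourier k).continuous.sub continuous_const).norm.pow 2).mul continuous_const
  · rw [Real.norm_of_nonneg (by positivity)]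
    exact fourierModulus_term_le k h

theorem fourierModulus_zero : fourierModulus 0 = 0 := by
  simp [fourierModulus]

variable {V : Type*} [NormedAddCommGroup V]

theorem sum_norm_mul_sq_le {J : Finset ℤ} {c : ℤ → V} {C : ℝ}
    (hc : ∑ k ∈ J, (1 + (k : ℝ) ^ 2) * ‖c k‖ ^ 2 ≤ C) {g : ℤ → ℝ}
    (hg : Summable fun k : ℤ => g k ^ 2 * (1 + (k : ℝ) ^ 2)⁻¹) :
    (∑ k ∈ J, g k * ‖c k‖) ^ 2 ≤ C * ∑' k : ℤ, g k ^ 2 * (1 + (k : ℝ) ^ 2)⁻¹ := by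
  refine (Finset.sum_sq_le_sum_mul_sum_of_sq_le_mul J
    (f := fun k : ℤ => (1 + (k : ℝ) ^ 2) * ‖c k‖ ^ 2)
    (g := fun k : ℤ => g k ^ 2 * (1 + (k : ℝ) ^ 2)⁻¹) (fun k _ => by positivity)
    (fun k _ => by positivity) fun k _ => ?_).trans ?_
  · have : 1 + (k : ℝ) ^ 2 ≠ 0 := by positivity
    exact le_of_eq (by field_simp)
  · have h0 : 0 ≤ ∑ k ∈ J, (1 + (k : ℝ) ^ 2) * ‖c k‖ ^ 2 :=
      Finset.sum_nonneg fun k _ => by positivity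
    exact mul_le_mul hc (hg.sum_le_tsum J fun k _ => by positivity)
      (Finset.sum_nonneg fun k _ => by positivity) (h0.trans hc)

variable [NormedSpace ℂ V]

theorem norm_trigPoly_sq_le {J : Finset ℤ} {c : ℤ → V} {C : ℝ}
    (hc : ∑ k ∈ J, (1 + (k : ℝ) ^ 2) * ‖c k‖ ^ 2 ≤ C) (t : UnitAddCircle) :
    ‖trigPoly J c t‖ ^ 2 ≤ C * ∑' k : ℤ, (1 + (k : ℝ) ^ 2)⁻¹ := by
  have h := sum_norm_mul_sq_le hc (g := fun _ => 1) (by simpa using summable_inv_one_add_int_sq)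
  simp only [one_pow, one_mul] at h
  refine (pow_le_pow_left₀ (norm_nonneg _) ((norm_sum_le _ _).trans_eq ?_) 2).trans h
  exact Finset.sum_congr rfl fun k _ => by rw [norm_smul, norm_fourier_apply, one_mul]

theorem norm_trigPoly_sub_sq_le {J : Finset ℤ} {c : ℤ → V} {C : ℝ}
    (hc : ∑ k ∈ J, (1 + (k : ℝ) ^ 2) * ‖c k‖ ^ 2 ≤ C) (s t : UnitAddCircle) :
    ‖trigPoly J c s - trigPoly J c t‖ ^ 2 ≤ C * fourierModulus (t - s) := by
  refine le_trans ?_ (sum_norm_mul_sq_le hc (summable_fourierModulus (t - s)))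
  refine pow_le_pow_left₀ (norm_nonneg _) ?_ 2
  rw [trigPoly, trigPoly, ← Finset.sum_sub_distrib]
  refine (norm_sum_le _ _).trans_eq (Finset.sum_congr rfl fun k _ => ?_)
  have h : (fourier k t : ℂ) = fourier k s * fourier k (t - s) := by
    rw [fourier_apply, fourier_apply, fourier_apply, ← Circle.coe_mul, ← AddCircle.toCircle_add,
      ← smul_add, add_sub_cancel]
  rw [← sub_smul, norm_smul, h, ← norm_neg, neg_sub, ← mul_sub_one, norm_mul, norm_fourier_apply,
    one_mul]

/-- Bounded sequences in the periodic first-order Sobolev space are relatively compact for the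
uniform norm. -/
theorem exists_tendsto_trigPoly {J : ℕ → Finset ℤ} {c : ℕ → ℤ → ComplexPlane} {C : ℝ}
    (hc : ∀ n, ∑ k ∈ J n, (1 + (k : ℝ) ^ 2) * ‖c n k‖ ^ 2 ≤ C) {m : ℕ → ℝ} {M : ℝ}
    (hm : ∀ n, |m n| ≤ M) :
    ∃ (z : UnitAddCircle → ComplexPlane) (l : ℝ) (φ : ℕ → ℕ), Continuous z ∧ |l| ≤ M ∧
      StrictMono φ ∧ (∀ t, Tendsto (fun n => trigPoly (J (φ n)) (c (φ n)) t) atTop (𝓝 (z t))) ∧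
      Tendsto (fun n => m (φ n)) atTop (𝓝 l) := by
  have hC : 0 ≤ C := (Finset.sum_nonneg fun k _ => by positivity).trans (hc 0)
  let F : ℕ → BoundedContinuousFunction UnitAddCircle ComplexPlane := fun n =>
    BoundedContinuousFunction.mkOfCompact ⟨_, continuous_trigPoly (J n) (c n)⟩
  have hF : ∀ n t, F n t = trigPoly (J n) (c n) t := fun n t => rfl
  have hcomp : IsCompact (closure (range F)) := by
    refine BoundedContinuousFunction.arzela_ascoli
      (closedBall 0 √(C * ∑' k : ℤ, (1 + (k : ℝ) ^ 2)⁻¹)) (isCompact_closedBall _ _) _ ?_ ?_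
    · rintro _ t ⟨n, rfl⟩
      rw [mem_closedBall_zero_iff, hF]
      exact Real.le_sqrt_of_sq_le (norm_trigPoly_sq_le (hc n) t)
    · intro s
      refine Metric.equicontinuousAt_of_continuity_modulus
        (fun t => √(C * fourierModulus (t - s))) ?_ _ (Eventually.of_forall ?_)
      · have h : Continuous fun t => √(C * fourierModulus (t - s)) :=
          (continuous_const.mul
            (continuous_fourierModulus.comp (continuous_id.sub continuous_const))).sqrt
        simpa [fourierModulus_zero] using h.tendsto s
      · rintro t ⟨_, n, rfl⟩
        rw [dist_eq_norm]
        exact Real.le_sqrt_of_sq_le (norm_trigPoly_sub_sq_le (hc n) s t)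
  obtain ⟨⟨z, l⟩, hzl, φ, hφ, hlim⟩ := (hcomp.prod (isCompact_Icc (a := -M) (b := M))).tendsto_subseq
    (x := fun n => (F n, m n)) fun n => ⟨subset_closure ⟨n, rfl⟩, abs_le.1 (hm n)⟩
  have h1 : Tendsto (fun n => F (φ n)) atTop (𝓝 z) := (continuous_fst.tendsto _).comp hlim
  refine ⟨z, l, φ, z.continuous, abs_le.2 hzl.2, hφ, fun t => ?_, (continuous_snd.tendsto _).comp hlim⟩
  exact ((BoundedContinuousFunction.evalCLM ℂ t).continuous.tendsto z).comp h1

theorem tendsto_fourierCoeff {u : ℕ → UnitAddCircle → V} (hu : ∀ n, Continuous (u n)) {B : ℝ}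
    (hB : ∀ n t, ‖u n t‖ ≤ B) {v : UnitAddCircle → V}
    (hv : ∀ t, Tendsto (fun n => u n t) atTop (𝓝 (v t))) (k : ℤ) :
    Tendsto (fun n => fourierCoeff (u n) k) atTop (𝓝 (fourierCoeff v k)) := by
  refine tendsto_integral_of_dominated_convergence (fun _ => B)
    (fun n => (integrable_fourier_smul (hu n) _).aestronglyMeasurable)
    (integrable_haarAddCircle continuous_const) (fun n => ae_of_all _ fun t => ?_)
    (ae_of_all _ fun t => (hv t).const_smul _)
  rw [norm_smul, norm_fourier_apply, one_mul]
  exact hB n t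

theorem one_add_sq_mul_norm_sq_le {m : ℝ} (hm : |m| ≤ 1 / 4) (k : ℤ) {x e : V}
    (h : (Complex.I * ((1 + m) * k - 1)) • x = e) :
    (1 + (k : ℝ) ^ 2) * ‖x‖ ^ 2 ≤ 5 * ‖x‖ ^ 2 + 4 * ‖e‖ ^ 2 := by
  have h1 : (((1 + m) * k : ℝ) : ℂ) • x = x - Complex.I • e := by
    rw [← h, smul_smul, ← mul_assoc, Complex.I_mul_I]
    push_cast
    module
  have h2 : |(1 + m) * k| * ‖x‖ ≤ ‖x‖ + ‖e‖ := by
    have := norm_sub_le x (Complex.I • e)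
    rwa [← h1, norm_smul, norm_smul, Complex.norm_I, one_mul, Complex.norm_real,
      Real.norm_eq_abs] at this
  have h3 : ((1 + m) * k) ^ 2 * ‖x‖ ^ 2 ≤ (‖x‖ + ‖e‖) ^ 2 := by
    rw [← sq_abs, ← mul_pow]
    exact pow_le_pow_left₀ (by positivity) h2 2
  have h4 : 9 / 16 ≤ (1 + m) ^ 2 := by nlinarith [(abs_le.1 hm).1]
  have h5 : 9 / 16 * ((k : ℝ) ^ 2 * ‖x‖ ^ 2) ≤ (1 + m) ^ 2 * ((k : ℝ) ^ 2 * ‖x‖ ^ 2) :=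
    mul_le_mul_of_nonneg_right h4 (by positivity)
  nlinarith [sq_nonneg (‖x‖ - ‖e‖), sq_nonneg ‖x‖, sq_nonneg ‖e‖]

/-- The equation `(1 + m) z' = 2π (i z + E z)` on the circle has a solution, in the sense of
Fourier coefficients. -/
theorem exists_fourier_solution {E : ComplexPlane → ComplexPlane} (hE : Continuous E)
    (hEε : ∀ p, ‖E p‖ ≤ 1 / 10 * ‖p‖) (hE0 : ∀ p, inner ℝ p (E p) = 0) :
    ∃ (z : UnitAddCircle → ComplexPlane) (m : ℝ), Continuous z ∧ |m| ≤ 1 / 4 ∧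
      ‖fourierCoeff z 1‖ = 1 ∧ ∀ k : ℤ, (Complex.I * ((1 + m) * k - 1)) • fourierCoeff z k =
        fourierCoeff (fun t => E (z t)) k := by
  let K : ℕ → Finset ℤ := fun n => (Finset.Icc (-(n : ℤ)) n).erase 1
  have hK : ∀ k : ℤ, ∀ᶠ n in atTop, k ∈ insert 1 (K n) := fun k => by
    filter_upwards [eventually_ge_atTop k.natAbs] with n hn
    simp only [K, Finset.mem_insert, Finset.mem_erase, Finset.mem_Icc]
    lia
  choose c m hm h1 hsum heq using fun n : ℕ =>
    exists_galerkin_solution (Finset.notMem_erase 1 (Finset.Icc (-(n : ℤ)) n)) hE hEε hE0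
  change ∀ n, ∑ k ∈ insert 1 (K n), ‖c n k‖ ^ 2 ≤ 2 at hsum
  change ∀ n, ∀ k ∈ insert 1 (K n), _ = fourierCoeff (fun t => E (trigPoly (insert 1 (K n)) _ t)) k
    at heq
  have hc : ∀ n, ∑ k ∈ insert 1 (K n), (1 + (k : ℝ) ^ 2) * ‖c n k‖ ^ 2 ≤ 11 := fun n => by
    have h2 := sum_norm_sq_fourierCoeff_comp_le hE hEε
      (continuous_trigPoly (insert 1 (K n)) (c n)) (insert 1 (K n))
    rw [integral_norm_sq_trigPoly] at h2
    refine (Finset.sum_le_sum fun k hk => one_add_sq_mul_norm_sq_le (hm n) k (heq n k hk)).trans ?_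
    rw [Finset.sum_add_distrib, ← Finset.mul_sum, ← Finset.mul_sum]
    linarith [hsum n]
  obtain ⟨z, l, φ, hz, hl, hφ, hlim, hml⟩ := exists_tendsto_trigPoly hc hm
  set B := √(11 * ∑' k : ℤ, (1 + (k : ℝ) ^ 2)⁻¹)
  have hB : ∀ n t, ‖trigPoly (insert 1 (K n)) (c n) t‖ ≤ B := fun n t =>
    Real.le_sqrt_of_sq_le (norm_trigPoly_sq_le (hc n) t)
  have hcz : ∀ k, Tendsto (fun n => c (φ n) k) atTop (𝓝 (fourierCoeff z k)) := fun k => by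
    refine (tendsto_fourierCoeff (fun n => continuous_trigPoly _ _) (fun n t => hB (φ n) t) hlim
      k).congr' ?_
    filter_upwards [hφ.tendsto_atTop.eventually (hK k)] with n hn
    rw [fourierCoeff_trigPoly, if_pos hn]
  have hEz : ∀ k, Tendsto (fun n => fourierCoeff
      (fun t => E (trigPoly (insert 1 (K (φ n))) (c (φ n)) t)) k) atTop
      (𝓝 (fourierCoeff (fun t => E (z t)) k)) :=
    tendsto_fourierCoeff (fun n => hE.comp (continuous_trigPoly _ _)) (B := 1 / 10 * B)
      (fun n t => (hEε _).trans (by linarith [hB (φ n) t])) fun t => (hE.tendsto _).comp (hlim t)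
  refine ⟨z, l, hz, hl, ?_, fun k => ?_⟩
  · refine tendsto_nhds_unique (hcz 1).norm ?_
    simp only [h1]
    exact tendsto_const_nhds
  · refine tendsto_nhds_unique ?_ (hEz k)
    have h2 : Tendsto (fun n => Complex.I * ((1 + (m (φ n) : ℂ)) * k - 1)) atTop
        (𝓝 (Complex.I * ((1 + (l : ℂ)) * k - 1))) :=
      ((((Complex.continuous_ofReal.tendsto l).comp hml).const_add 1).mul_const _
        |>.sub_const 1).const_mul _
    refine (h2.smul (hcz k)).congr' ?_
    filter_upwards [hφ.tendsto_atTop.eventually (hK k)] with n hn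
    exact heq (φ n) k hn

end Limit

section Regularity

theorem fourierCoeff_eq_fourierCoeffOn (u : UnitAddCircle → ℂ) (n : ℤ) :
    fourierCoeff u n = fourierCoeffOn (lt_add_of_pos_right (0 : ℝ) one_pos)
      (fun x : ℝ => u (x : UnitAddCircle)) n := by
  rw [← fourierCoeff_liftIco_eq]
  congr 1
  funext x
  exact congrArg u ((AddCircle.equivIco 1 0).symm_apply_apply x).symm

/-- The Fourier coefficients of the derivative of a periodic function. -/
theorem fourierCoeff_deriv {u v : UnitAddCircle → ℂ} (hv : Continuous v)
    (h : ∀ t : ℝ, HasDerivAt (fun s : ℝ => u s) (v t) t) {n : ℤ} (hn : n ≠ 0) :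
    2 * Real.pi * Complex.I * n * fourierCoeff u n = fourierCoeff v n := by
  rw [fourierCoeff_eq_fourierCoeffOn, fourierCoeff_eq_fourierCoeffOn,
    fourierCoeffOn_of_hasDerivAt _ hn (fun x _ => h x)
      ((hv.comp (AddCircle.continuous_mk' 1)).intervalIntegrable _ _)]
  have h1 : u ((0 + 1 : ℝ) : UnitAddCircle) = u ((0 : ℝ) : UnitAddCircle) := by
    congr 1
    rw [zero_add]
    exact (AddCircle.coe_period 1)
  have hn' : (n : ℂ) ≠ 0 := by exact_mod_cast hn
  have hpi : (Real.pi : ℂ) ≠ 0 := by exact_mod_cast Real.pi_ne_zero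
  rw [h1]
  push_cast
  field_simp [Complex.I_ne_zero]
  ring

theorem eq_const_of_fourierCoeff_eq_zero {u : UnitAddCircle → ℂ} (hu : Continuous u)
    (h : ∀ n : ℤ, n ≠ 0 → fourierCoeff u n = 0) (t : UnitAddCircle) : u t = fourierCoeff u 0 := by
  have hs : HasSum (fun n : ℤ => fourierCoeff u n • fourier n t) (fourierCoeff u 0) := by
    have := hasSum_single (f := fun n : ℤ => fourierCoeff u n • fourier n t) 0 fun n hn => by
      rw [h n hn, zero_smul]
    simpa using this
  refine HasSum.unique ?_ hs
  exact has_pointwise_sum_fourier_series_of_summable (f := ⟨u, hu⟩)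
    (summable_of_ne_finset_zero (s := {0}) fun n hn => h n (by simpa using hn)) t

/-- A continuous function on the circle is differentiable as soon as its formal Fourier derivative
is continuous. -/
theorem hasDerivAt_of_fourierCoeff {g v : UnitAddCircle → ℂ} (hg : Continuous g)
    (hv : Continuous v)
    (h : ∀ n : ℤ, 2 * Real.pi * Complex.I * n * fourierCoeff g n = fourierCoeff v n) (t : ℝ) :
    HasDerivAt (fun s : ℝ => g s) (v t) t := by
  have hvc : Continuous fun s : ℝ => v s := hv.comp (AddCircle.continuous_mk' 1)
  set P : ℝ → ℂ := fun s => ∫ x in (0 : ℝ)..s, v x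
  have hP : ∀ s : ℝ, HasDerivAt P (v s) s := fun s =>
    intervalIntegral.integral_hasDerivAt_right (hvc.intervalIntegrable _ _)
      (hvc.stronglyMeasurableAtFilter _ _) hvc.continuousAt
  have hv0 : ∫ x in (0 : ℝ)..0 + 1, v x = 0 := by
    have h0 := h 0
    rw [fourierCoeff_eq_intervalIntegral v 0 0] at h0
    simpa using h0.symm
  have hvper : Periodic (fun s : ℝ => v s) 1 := fun s => by
    change v _ = v _
    rw [AddCircle.coe_add, AddCircle.coe_period, add_zero]
  have hper : Periodic P 1 := fun s => by
    have h1 := intervalIntegral.integral_add_adjacent_intervals (a := (0 : ℝ)) (b := s) (c := s + 1)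
      (hvc.intervalIntegrable _ _) (hvc.intervalIntegrable (μ := volume) _ _)
    rw [hvper.intervalIntegral_add_eq s 0, hv0, add_zero] at h1
    exact h1.symm
  have hW : Continuous hper.lift :=
    Continuous.quotient_liftOn' (continuous_iff_continuousAt.2 fun s => (hP s).continuousAt) _
  have hWP : ∀ s : ℝ, hper.lift (s : UnitAddCircle) = P s := fun s => rfl
  have hconst := eq_const_of_fourierCoeff_eq_zero (hg.sub hW) fun n hn => by
    have h1 := fourierCoeff_deriv hv (u := hper.lift) hP hn
    have h2 : fourierCoeff (g - hper.lift) n =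
        fourierCoeff g n - fourierCoeff hper.lift n := by
      simp only [fourierCoeff, Pi.sub_apply, smul_sub]
      exact integral_sub (integrable_fourier_smul hg _) (integrable_fourier_smul hW _)
    rw [← h n] at h1
    have h3 : 2 * Real.pi * Complex.I * (n : ℂ) ≠ 0 := by simp [hn, Real.pi_ne_zero]
    rw [h2, ← mul_left_cancel₀ h3 h1, sub_self]
  refine ((hP t).add_const (fourierCoeff (g - hper.lift) 0)).congr_of_eventuallyEq
    (Eventually.of_forall fun s => ?_)
  change g s = P s + _
  rw [← hconst s, Pi.sub_apply, hWP s, add_sub_cancel]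

theorem fourierCoeff_apply {z : UnitAddCircle → ComplexPlane} (hz : Continuous z) (n : ℤ)
    (i : Fin 2) : fourierCoeff z n i = fourierCoeff (fun t => z t i) n :=
  ((EuclideanSpace.proj i : ComplexPlane →L[ℂ] ℂ).integral_comp_comm
    (integrable_fourier_smul hz (-n))).symm

theorem fourierCoeff_smul_smul_add {V : Type*} [NormedAddCommGroup V] [NormedSpace ℂ V]
    {u w : UnitAddCircle → V} (hu : Continuous u) (hw : Continuous w) (a b : ℂ) (n : ℤ) :
    fourierCoeff (fun t => a • (b • u t + w t)) n = a • (b • fourierCoeff u n + fourierCoeff w n) := by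
  have h1 : ∀ t : UnitAddCircle, (fourier (-n) t : ℂ) • a • (b • u t + w t) =
      a • (b • (fourier (-n) t : ℂ) • u t + (fourier (-n) t : ℂ) • w t) := fun t => by
    module
  have h2 : Integrable (fun t => b • (fourier (-n) t : ℂ) • u t) AddCircle.haarAddCircle :=
    (integrable_fourier_smul hu _).smul b
  simp only [fourierCoeff, h1]
  rw [integral_smul, integral_add h2 (integrable_fourier_smul hw _), integral_smul]

theorem hasDerivAt_of_fourierCoeff_smul {z v : UnitAddCircle → ComplexPlane} (hz : Continuous z)
    (hv : Continuous v)
    (h : ∀ n : ℤ, (2 * Real.pi * Complex.I * n) • fourierCoeff z n = fourierCoeff v n) (t : ℝ) :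
    HasDerivAt (fun s : ℝ => z s) (v t) t := by
  have h2 : ∀ i, HasDerivAt (fun s : ℝ => z s i) (v t i) t := fun i => by
    refine hasDerivAt_of_fourierCoeff (g := fun s => z s i) (v := fun s => v s i)
      (by fun_prop) (by fun_prop) (fun n => ?_) t
    rw [← fourierCoeff_apply hz, ← fourierCoeff_apply hv, ← h n]
    rfl
  exact (PiLp.hasFDerivAt_toLp (𝕜 := ℝ) 2 _).comp_hasDerivAt t (hasDerivAt_pi.2 h2)

/-- Existence of a periodic solution of `z' = i z + E z`. -/
theorem exists_periodic_solution {E : ComplexPlane → ComplexPlane} (hE : Continuous E)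
    (hEε : ∀ p, ‖E p‖ ≤ 1 / 10 * ‖p‖) (hE0 : ∀ p, inner ℝ p (E p) = 0) :
    ∃ (z : ℝ → ComplexPlane) (T r : ℝ), 0 < T ∧ 0 < r ∧ (∀ t, z (t + T) = z t) ∧
      (∀ t, ‖z t‖ = r) ∧ ∀ t, HasDerivAt z (Complex.I • z t + E (z t)) t := by
  obtain ⟨z, m, hz, hm, h1, hk⟩ := exists_fourier_solution hE hEε hE0
  have hm0 : 0 < 1 + m := by linarith [(abs_le.1 hm).1]
  have hm0' : (1 + m : ℂ) ≠ 0 := by exact_mod_cast hm0.ne'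
  have hEz : Continuous fun t => E (z t) := hE.comp hz
  set T : ℝ := 2 * Real.pi / (1 + m) with hT
  have hT0 : 0 < T := by positivity
  set v : UnitAddCircle → ComplexPlane := fun t => (T : ℂ) • (Complex.I • z t + E (z t)) with hv
  have hvc : Continuous v := by fun_prop
  have hvk : ∀ n : ℤ, (2 * Real.pi * Complex.I * n) • fourierCoeff z n = fourierCoeff v n := by
    intro n
    rw [hv, fourierCoeff_smul_smul_add hz hEz, ← hk n, ← add_smul, smul_smul, hT]
    congr 1
    push_cast
    field_simp
    ring
  have hderiv : ∀ t : ℝ, HasDerivAt (fun s : ℝ => z s) (v t) t := fun t => by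
    exact hasDerivAt_of_fourierCoeff_smul hz hvc hvk t
  set γ : ℝ → ComplexPlane := fun t => z ((t / T : ℝ) : UnitAddCircle)
  have hγ : ∀ t, HasDerivAt γ (Complex.I • γ t + E (γ t)) t := fun t => by
    have h2 := (hderiv (t / T)).scomp t ((hasDerivAt_id t).div_const T)
    refine h2.congr_deriv ?_
    have h3 : v ((t / T : ℝ) : UnitAddCircle) = T • (Complex.I • γ t + E (γ t)) :=
      Complex.coe_smul T _
    rw [h3, smul_smul, one_div, inv_mul_cancel₀ hT0.ne', one_smul]
  have hnorm : ∀ t, ‖γ t‖ = ‖γ 0‖ := fun t => by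
    refine (sq_eq_sq₀ (norm_nonneg _) (norm_nonneg _)).1 ?_
    refine is_const_of_deriv_eq_zero (f := fun t => ‖γ t‖ ^ 2)
      (fun s => (hγ s).norm_sq.differentiableAt) (fun s => ?_) t 0
    rw [(hγ s).norm_sq.deriv, inner_add_right, hE0]
    have := inner_I_smul_self 1 (γ s)
    rw [Complex.ofReal_one, mul_one] at this
    rw [this, add_zero, mul_zero]
  refine ⟨γ, T, ‖γ 0‖, hT0, norm_pos_iff.2 fun h0 => ?_, fun t => ?_, hnorm, hγ⟩
  · have hz0 : z = 0 := by
      funext x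
      obtain ⟨s, rfl⟩ := QuotientAddGroup.mk_surjective x
      have h2 := hnorm (s * T)
      rw [h0, norm_zero, norm_eq_zero] at h2
      simp only [γ, mul_div_cancel_right₀ s hT0.ne'] at h2
      exact h2
    rw [hz0] at h1
    simp [fourierCoeff] at h1
  · change z _ = z _
    rw [add_div, div_self hT0.ne', AddCircle.coe_add, AddCircle.coe_period, add_zero]

end Regularity

section Radial

variable {V : Type*} [NormedAddCommGroup V] [NormedSpace ℝ V]

open Classical in
/-- The extension of a function on the unit sphere to a positively homogeneous function. -/
noncomputable def radialExtension (Y : sphere (0 : V) 1 → V) (p : V) : V :=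
  if h : p = 0 then 0 else ‖p‖ • Y ⟨‖p‖⁻¹ • p, by
    rw [mem_sphere_zero_iff_norm, norm_smul, norm_inv, norm_norm,
      inv_mul_cancel₀ (norm_ne_zero_iff.2 h)]⟩

theorem radialExtension_zero (Y : sphere (0 : V) 1 → V) : radialExtension Y 0 = 0 := dif_pos rfl

theorem radialExtension_smul (Y : sphere (0 : V) 1 → V) {r : ℝ} (hr : 0 < r)
    (q : sphere (0 : V) 1) : radialExtension Y (r • (q : V)) = r • Y q := by
  have hq : ‖(q : V)‖ = 1 := mem_sphere_zero_iff_norm.1 q.2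
  have hn : ‖r • (q : V)‖ = r := by rw [norm_smul, hq, mul_one, Real.norm_of_nonneg hr.le]
  have h0 : r • (q : V) ≠ 0 := norm_ne_zero_iff.1 (hn.trans_ne hr.ne')
  rw [radialExtension, dif_neg h0]
  congr 1
  · congr 1
    ext1
    simp only [hn, smul_smul, inv_mul_cancel₀ hr.ne', one_smul]

theorem exists_eq_smul_sphere {p : V} (hp : p ≠ 0) :
    ∃ q : sphere (0 : V) 1, p = ‖p‖ • (q : V) := by
  have h := norm_ne_zero_iff.2 hp
  refine ⟨⟨‖p‖⁻¹ • p, ?_⟩, ?_⟩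
  · rw [mem_sphere_zero_iff_norm, norm_smul, norm_inv, norm_norm, inv_mul_cancel₀ h]
  · rw [smul_smul, mul_inv_cancel₀ h, one_smul]

theorem norm_radialExtension_le {Y : sphere (0 : V) 1 → V} {ε : ℝ} (hY : ∀ q, ‖Y q‖ ≤ ε) (p : V) :
    ‖radialExtension Y p‖ ≤ ε * ‖p‖ := by
  rcases eq_or_ne p 0 with rfl | hp
  · simp [radialExtension_zero]
  · rw [radialExtension, dif_neg hp, norm_smul, norm_norm, mul_comm]
    exact mul_le_mul_of_nonneg_right (hY _) (norm_nonneg _)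

theorem continuous_radialExtension {Y : sphere (0 : V) 1 → V} (hY : Continuous Y) {ε : ℝ}
    (hYε : ∀ q, ‖Y q‖ ≤ ε) : Continuous (radialExtension Y) := by
  refine continuous_iff_continuousAt.2 fun p => ?_
  rcases eq_or_ne p 0 with rfl | hp
  · rw [ContinuousAt, radialExtension_zero]
    refine squeeze_zero_norm (norm_radialExtension_le hYε) ?_
    have h : Continuous fun p : V => ε * ‖p‖ := by fun_prop
    simpa using h.tendsto 0
  · have hopen : IsOpen {p : V | p ≠ 0} := isOpen_ne
    refine ContinuousOn.continuousAt (continuousOn_iff_continuous_domRestrict.2 ?_)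
      (hopen.mem_nhds hp)
    have h : ∀ p : {p : V | p ≠ 0}, ‖(p : V)‖⁻¹ • (p : V) ∈ sphere (0 : V) 1 := fun p => by
      rw [mem_sphere_zero_iff_norm, norm_smul, norm_inv, norm_norm,
        inv_mul_cancel₀ (norm_ne_zero_iff.2 p.2)]
    have h1 : Continuous fun p : {p : V | p ≠ 0} => ‖(p : V)‖⁻¹ • (p : V) :=
      (continuous_subtype_val.norm.inv₀ fun p => norm_ne_zero_iff.2 p.2).smul
        continuous_subtype_val
    have h2 : Continuous fun p : {p : V | p ≠ 0} => ‖(p : V)‖ • Y ⟨‖(p : V)‖⁻¹ • (p : V), h p⟩ :=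
      continuous_subtype_val.norm.smul (hY.comp (h1.subtype_mk h))
    convert h2 using 2 with p
    exact dif_neg p.2

theorem inner_radialExtension {V : Type*} [NormedAddCommGroup V] [InnerProductSpace ℝ V]
    {Y : sphere (0 : V) 1 → V} (hY : ∀ q : sphere (0 : V) 1, inner ℝ (q : V) (Y q) = 0) (p : V) :
    inner ℝ p (radialExtension Y p) = 0 := by
  rcases eq_or_ne p 0 with rfl | hp
  · rw [inner_zero_left]
  · obtain ⟨q, hq⟩ := exists_eq_smul_sphere hp
    rw [hq, radialExtension_smul Y (norm_pos_iff.2 hp), real_inner_smul_left, real_inner_smul_right,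
      hY, mul_zero, mul_zero]

end Radial

section Hopf

/-- The identification of `ℂ²` with `ℝ⁴` by real and imaginary parts. -/
noncomputable def complexPlaneEquiv : ComplexPlane ≃ₗᵢ[ℝ] EuclideanSpace ℝ (Fin 4) where
  toFun z := !₂[(z 0).re, (z 0).im, (z 1).re, (z 1).im]
  invFun p := !₂[⟨p 0, p 1⟩, ⟨p 2, p 3⟩]
  map_add' x y := by
    ext i; fin_cases i <;> simp
  map_smul' r x := by
    ext i; fin_cases i <;> simp
  left_inv z := by
    ext i; fin_cases i <;> simp
  right_inv p := by
    ext i; fin_cases i <;> simp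
  norm_map' z := by
    refine (sq_eq_sq₀ (norm_nonneg _) (norm_nonneg _)).1 ?_
    rw [EuclideanSpace.norm_sq_eq, EuclideanSpace.norm_sq_eq]
    simp [Fin.sum_univ_four, ← Complex.normSq_eq_norm_sq, Complex.normSq_apply]
    ring

theorem complexPlaneEquiv_I_smul (z : ComplexPlane) :
    complexPlaneEquiv (Complex.I • z) = hopfField (complexPlaneEquiv z) := by
  ext i; fin_cases i <;> simp [complexPlaneEquiv, hopfField]

theorem hopfField_smul (r : ℝ) (p : EuclideanSpace ℝ (Fin 4)) :
    hopfField (r • p) = r • hopfField p := by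
  ext i; fin_cases i <;> simp [hopfField]

theorem continuous_hopfField : Continuous hopfField := by
  unfold hopfField
  refine (EuclideanSpace.equiv (Fin 4) ℝ).symm.continuous.comp (continuous_pi fun i => ?_)
  fin_cases i <;> simp <;> fun_prop

theorem inner_hopfField (p : EuclideanSpace ℝ (Fin 4)) : inner ℝ p (hopfField p) = 0 := by
  simp [PiLp.inner_apply, Fin.sum_univ_four, hopfField]
  ring

end Hopf

end Auxiliary

/-- **Seifert's theorem.** Every sufficiently small `C¹` perturbation of the Hopf
vector field on the 3-sphere has a periodic orbit. -/
theorem seifert_perturbation_of_hopf_has_periodic_orbit :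
    ∃ ε : ℝ, 0 < ε ∧
      ∀ X : sphere (0 : EuclideanSpace ℝ (Fin 4)) 1 → EuclideanSpace ℝ (Fin 4),
        ContMDiff (𝓡 3) 𝓘(ℝ, EuclideanSpace ℝ (Fin 4)) 1 X →
        (∀ p : sphere (0 : EuclideanSpace ℝ (Fin 4)) 1,
          inner ℝ (X p) (p : EuclideanSpace ℝ (Fin 4)) = (0 : ℝ)) →
        (∀ p : sphere (0 : EuclideanSpace ℝ (Fin 4)) 1, X p ≠ 0) →
        (∀ p : sphere (0 : EuclideanSpace ℝ (Fin 4)) 1,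
          ‖X p - hopfField (p : EuclideanSpace ℝ (Fin 4))‖ < ε) →
        ∃ (γ : ℝ → EuclideanSpace ℝ (Fin 4))
          (hγ : ∀ t : ℝ, γ t ∈ sphere (0 : EuclideanSpace ℝ (Fin 4)) 1),
          (∀ t : ℝ, HasDerivAt γ (X ⟨γ t, hγ t⟩) t) ∧
          (∃ s t : ℝ, γ s ≠ γ t) ∧
          (∃ T : ℝ, 0 < T ∧ ∀ t : ℝ, γ (t + T) = γ t) := by
  refine ⟨1 / 10, by norm_num, fun X hX hXtan hX0 hXε => ?_⟩
  set Y : sphere (0 : EuclideanSpace ℝ (Fin 4)) 1 → EuclideanSpace ℝ (Fin 4) :=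
    fun p => X p - hopfField p with hY
  have hYc : Continuous Y :=
    hX.continuous.sub (continuous_hopfField.comp continuous_subtype_val)
  have hYε : ∀ p, ‖Y p‖ ≤ 1 / 10 := fun p => (hXε p).le
  have hYtan : ∀ p : sphere (0 : EuclideanSpace ℝ (Fin 4)) 1,
      inner ℝ (p : EuclideanSpace ℝ (Fin 4)) (Y p) = 0 := fun p => by
    rw [hY, inner_sub_right, inner_hopfField, real_inner_comm, hXtan, sub_zero]
  obtain ⟨z, T, r, hT, hr, hper, hnorm, hz⟩ := exists_periodic_solution
    (E := fun w => complexPlaneEquiv.symm (radialExtension Y (complexPlaneEquiv w)))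
    (complexPlaneEquiv.symm.continuous.comp
      ((continuous_radialExtension hYc hYε).comp complexPlaneEquiv.continuous))
    (fun w => by
      rw [LinearIsometryEquiv.norm_map, ← complexPlaneEquiv.norm_map w]
      exact norm_radialExtension_le hYε _)
    (fun w => by
      rw [← complexPlaneEquiv.inner_map_map, LinearIsometryEquiv.apply_symm_apply]
      exact inner_radialExtension hYtan _)
  have hγ : ∀ t, r⁻¹ • complexPlaneEquiv (z t) ∈ sphere (0 : EuclideanSpace ℝ (Fin 4)) 1 :=
    fun t => by
      rw [mem_sphere_zero_iff_norm, norm_smul, LinearIsometryEquiv.norm_map, hnorm,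
        Real.norm_of_nonneg (inv_nonneg.2 hr.le), inv_mul_cancel₀ hr.ne']
  have hderiv : ∀ t, HasDerivAt (fun t => r⁻¹ • complexPlaneEquiv (z t)) (X ⟨_, hγ t⟩) t := by
    intro t
    have h1 := (complexPlaneEquiv.toContinuousLinearEquiv.hasFDerivAt.comp_hasDerivAt t
      (hz t)).const_smul r⁻¹
    refine h1.congr_deriv ?_
    have h2 : complexPlaneEquiv (z t) = r • r⁻¹ • complexPlaneEquiv (z t) := by
      rw [smul_smul, mul_inv_cancel₀ hr.ne', one_smul]
    have h3 : radialExtension Y (complexPlaneEquiv (z t)) = r • Y ⟨_, hγ t⟩ := by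
      rw [← radialExtension_smul Y hr, ← h2]
    change r⁻¹ • complexPlaneEquiv (Complex.I • z t + complexPlaneEquiv.symm _) = _
    rw [map_add, LinearIsometryEquiv.apply_symm_apply, h3, complexPlaneEquiv_I_smul, smul_add,
      ← hopfField_smul, smul_smul, inv_mul_cancel₀ hr.ne', one_smul, hY, add_sub_cancel]
  refine ⟨_, hγ, hderiv, ?_, T, hT, fun t => by simp only [hper]⟩
  by_contra! hconst
  refine hX0 ⟨_, hγ 0⟩ ((hderiv 0).unique ?_)
  exact (hasDerivAt_const 0 (r⁻¹ • complexPlaneEquiv (z 0))).congr_of_eventuallyEq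
    (Filter.Eventually.of_forall fun t => hconst t 0)
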